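/- arXiv:cs/0506056 — 8 statements merged into one kernel-verified Lean document; each statement's English description precedes it below -/
import Mathlib

section
/- Fix c ≥ 1 and ε > 0. There is a constant C (depending only on c and ε) such that for every n there exists a finite set 𝒬 of probability distributions over {1,…,n}, each with all probabilities strictly positive, with |𝒬| ≤ 2^{C · n^{1/c} · log n}, such that for every probability distribution P = p_1,…,p_n over {1,…,n} there is some Q ∈ 𝒬 with D(P ‖ Q) < (c − 1) H(P) + ε. -/
/-- `follow α S` is the string `S_α` whose `i`th character is the character immediately
following the `i`th occurrence of `α` in `S` (when the empty string `α = []`,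
this is `S` itself). -/
def follow {A : Type*} [DecidableEq A] (α S : List A) : List A :=
  (List.range S.length).filterMap fun i =>
    if (S.drop i).take α.length = α then (S.drop (i + α.length)).head? else none

/-- the number `#_α(S)` of occurrences of a non-empty string `α` as a substring of `S` -/
def countOcc {A : Type*} [DecidableEq A] (α S : List A) : ℕ :=
  ((List.range S.length).filter fun i => (S.drop i).take α.length = α).length

/-- the zeroth-order empirical entropy `H_0(S) = Σ_{a∈S} (#_a(S)/m) log₂(m/#_a(S))` -/
noncomputable def H0 {A : Type*} [DecidableEq A] (S : List A) : ℝ :=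
  ∑ a ∈ S.toFinset, ((S.count a : ℝ) / S.length) * Real.logb 2 ((S.length : ℝ) / (S.count a))

/-- the `ℓ`th-order empirical entropy of a string over the alphabet `Fin n`:
`H_ℓ(S) = (1/m) Σ_{|α| = ℓ} |S_α| H_0(S_α)` for `ℓ ≥ 1`, and `H_0(S)` for `ℓ = 0`. -/
noncomputable def empEnt (n ℓ : ℕ) (S : List (Fin n)) : ℝ :=
  if ℓ = 0 then H0 S
  else (S.length : ℝ)⁻¹ *
    ∑ α : Fin ℓ → Fin n, ((follow (List.ofFn α) S).length : ℝ) * H0 (follow (List.ofFn α) S)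

/-- Shannon entropy (base 2) of a distribution on `Fin n` -/
noncomputable def entropy {n : ℕ} (P : Fin n → ℝ) : ℝ :=
  ∑ a, P a * Real.logb 2 (1 / P a)

/-- relative entropy (Kullback-Leibler distance, base 2) `D(P‖Q)` -/
noncomputable def relEnt {n : ℕ} (P Q : Fin n → ℝ) : ℝ :=
  ∑ a, P a * Real.logb 2 (P a / Q a)

/-- the normalized distribution of the characters of a string -/
noncomputable def normDist {n : ℕ} (L : List (Fin n)) : Fin n → ℝ :=
  fun a => (L.count a : ℝ) / L.length

/-- An `ℓ`th-order Markov process over the alphabet `Fin n` (which emits the first `ℓ`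
characters with probability 1), specified by a probability distribution `q α` over the
alphabet for each context `α` of length `ℓ`. -/
structure MarkovProcess (n ℓ : ℕ) where
  q : List (Fin n) → Fin n → ℝ
  nonneg : ∀ α a, 0 ≤ q α a
  sum_one : ∀ α : List (Fin n), α.length = ℓ → ∑ a, q α a = 1

/-- `Pr[Q emits S] = ∏_{i=ℓ+1}^m q_{s_{i−ℓ}⋯s_{i−1}, s_i}` for an `ℓ`th-order Markov
process that emits `s_1⋯s_ℓ` with probability 1. -/
noncomputable def emitProb {n : ℕ} (ℓ : ℕ) (Q : MarkovProcess n ℓ) (S : List (Fin n)) : ℝ :=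
  ∏ i : Fin S.length,
    if ℓ ≤ (i : ℕ) then Q.q ((S.drop ((i : ℕ) - ℓ)).take ℓ) (S.get i) else 1

/-- the indicator variable which is 1 iff `α = s_{i+1}⋯s_{i+ℓ}` occurs (0-indexed) at
position `i` in `S` and the next character `s_{i+ℓ+1}` does not occur in `α` -/
def Xvar {n m : ℕ} (ℓ : ℕ) (α : Fin ℓ → Fin n) (i : ℕ) (S : Fin m → Fin n) : ℕ :=
  if h : i + ℓ < m then
    if (∀ j : Fin ℓ, S ⟨i + j.1, by have := j.2; omega⟩ = α j) ∧
        (∀ j : Fin ℓ, α j ≠ S ⟨i + ℓ, h⟩) then 1 else 0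
  else 0

open scoped BigOperators

/-- the distribution attached to a sequence of `M` characters, smoothed by the uniform one -/
noncomputable def smoothQ (n M : ℕ) (η : ℝ) (s : Fin M → Fin n) : Fin n → ℝ :=
  fun a => (1 - η) * (((Finset.univ.filter fun j => s j = a).card : ℝ) / M) + η / n

lemma exists_seq {n M : ℕ} (hn : 0 < n) (k : Fin n → ℕ) (hk : ∑ a, k a ≤ M) :
    ∃ s : Fin M → Fin n, ∀ a, k a ≤ (Finset.univ.filter fun j => s j = a).card := by
  have hcard : Fintype.card (Σ a, Fin (k a)) ≤ Fintype.card (Fin M) := by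
    simpa using hk
  obtain ⟨e⟩ := Function.Embedding.nonempty_of_card_le hcard
  refine ⟨Function.extend e Sigma.fst (fun _ => ⟨0, hn⟩), fun a => ?_⟩
  have : (Finset.univ : Finset (Fin (k a))).card ≤
      (Finset.univ.filter fun j =>
        Function.extend e Sigma.fst (fun _ => (⟨0, hn⟩ : Fin n)) j = a).card := by
    apply Finset.card_le_card_of_injOn (fun t => e ⟨a, t⟩)
    · intro t _
      simp [e.injective.extend_apply]
    · intro t _ t' _ h
      simpa using e.injective h
  simpa using this

lemma smoothQ_sum {n M : ℕ} (hn : 0 < n) (hM : 0 < M) (η : ℝ) (s : Fin M → Fin n) :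
    ∑ a, smoothQ n M η s a = 1 := by
  have h1 : ∑ a : Fin n, ((Finset.univ.filter fun j => s j = a).card : ℝ) = M := by
    have := Finset.card_eq_sum_card_fiberwise (f := s) (s := Finset.univ) (t := Finset.univ)
      (by intro x _; simp)
    simp only [Finset.card_univ, Fintype.card_fin] at this
    exact_mod_cast this.symm
  have hn' : (n : ℝ) ≠ 0 := by positivity
  have hM' : (M : ℝ) ≠ 0 := by positivity
  unfold smoothQ
  rw [Finset.sum_add_distrib, ← Finset.mul_sum, ← Finset.sum_div, h1]
  simp
  field_simp
  ring

lemma term_bound (c ε p q : ℝ) (hp : 0 < p) (hq : (2 : ℝ) ^ (-(ε / 2)) * p ^ c ≤ q) :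
    Real.logb 2 (p / q) ≤ (c - 1) * Real.logb 2 (1 / p) + ε / 2 := by
  have h0 : (0 : ℝ) < (2 : ℝ) ^ (-(ε / 2)) * p ^ c := by positivity
  have hq0 : 0 < q := lt_of_lt_of_le h0 hq
  have h1 := Real.logb_le_logb_of_le (b := 2) (by norm_num) h0 hq
  rw [Real.logb_mul (by positivity) (by positivity), Real.logb_rpow (by norm_num) (by norm_num),
    Real.logb_rpow_eq_mul_logb_of_pos hp] at h1
  rw [Real.logb_div hp.ne' hq0.ne', Real.logb_div one_ne_zero hp.ne', Real.logb_one]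
  linarith

/-- for fixed `c ≥ 1` and `ε > 0` there is a constant `C` such that for every
`n` there is a set of at most `2^{C n^{1/c} log n}` strictly positive distributions over
`{1,…,n}` containing, for each distribution `P`, some `Q` with
`D(P‖Q) < (c−1) H(P) + ε`. -/
theorem statement2 (c ε : ℝ) (hc : 1 ≤ c) (hε : 0 < ε) :
    ∃ C : ℝ, 0 < C ∧ ∀ n : ℕ, 0 < n →
      ∃ 𝒬 : Finset (Fin n → ℝ),
        (∀ Q ∈ 𝒬, (∀ a, 0 < Q a) ∧ ∑ a, Q a = 1) ∧
        (𝒬.card : ℝ) ≤ 2 ^ (C * (n : ℝ) ^ ((1 : ℝ) / c) * Real.logb 2 n) ∧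
        ∀ P : Fin n → ℝ, (∀ a, 0 ≤ P a) → ∑ a, P a = 1 →
          ∃ Q ∈ 𝒬, relEnt P Q < (c - 1) * entropy P + ε := by
  set r : ℝ := (2 : ℝ) ^ (-(ε / 4)) with hr
  have hr0 : 0 < r := by positivity
  have hr1 : r < 1 := Real.rpow_lt_one_of_one_lt_of_neg (by norm_num) (by linarith)
  have hrr : r * r = (2 : ℝ) ^ (-(ε / 2)) := by
    rw [hr, ← Real.rpow_add (by norm_num)]; congr 1; ring
  obtain ⟨η, hη⟩ : ∃ η, η = 1 - r := ⟨_, rfl⟩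
  have hη0 : 0 < η := by linarith
  have hη1 : η < 1 := by linarith
  have hcpos : 0 < c := by linarith
  refine ⟨1 / η ^ 2 + 1, by positivity, fun n hn => ?_⟩
  have hn1 : (1 : ℝ) ≤ n := by exact_mod_cast hn
  have hn0 : (0 : ℝ) < n := by linarith
  set x : ℝ := (n : ℝ) ^ ((1 : ℝ) / c) with hx
  have hx1 : 1 ≤ x := Real.one_le_rpow hn1 (by positivity)
  have hx0 : 0 < x := by linarith
  have hxc : x ^ c = n := by
    rw [hx, ← Real.rpow_mul hn0.le]; field_simp; simp
  obtain ⟨M, hM⟩ : ∃ M, M = ⌈1 / η ^ 2 * x⌉₊ := ⟨_, rfl⟩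
  have hMl : 1 / η ^ 2 * x ≤ M := by rw [hM]; exact Nat.le_ceil _
  have hMu : (M : ℝ) ≤ (1 / η ^ 2 + 1) * x := by
    have : (M : ℝ) < 1 / η ^ 2 * x + 1 := by
      rw [hM]; exact Nat.ceil_lt_add_one (by positivity)
    linarith
  have hM0' : (0 : ℝ) < M := lt_of_lt_of_le (by positivity) hMl
  have hM0 : 0 < M := by exact_mod_cast hM0'
  classical
  refine ⟨Finset.univ.image (smoothQ n M η), ?_, ?_, ?_⟩
  · intro Q hQ
    obtain ⟨s, -, rfl⟩ := Finset.mem_image.1 hQ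
    refine ⟨fun a => ?_, smoothQ_sum hn hM0 η s⟩
    unfold smoothQ
    have : 0 ≤ 1 - η := by linarith
    positivity
  · have h1 : ((Finset.univ.image (smoothQ n M η)).card : ℝ) ≤ (n : ℝ) ^ M := by
      have := Finset.card_image_le (s := (Finset.univ : Finset (Fin M → Fin n)))
        (f := smoothQ n M η)
      simp only [Finset.card_univ, Fintype.card_fun, Fintype.card_fin] at this
      exact_mod_cast this
    refine h1.trans ?_
    have h2 : (n : ℝ) ^ M = (2 : ℝ) ^ ((M : ℝ) * Real.logb 2 n) := by
      rw [mul_comm, Real.rpow_mul (by norm_num), Real.rpow_logb (by norm_num) (by norm_num) hn0,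
        Real.rpow_natCast]
    rw [h2]
    apply Real.rpow_le_rpow_of_exponent_le (by norm_num)
    exact mul_le_mul_of_nonneg_right hMu (Real.logb_nonneg (by norm_num) hn1)
  · intro P hP hP1
    obtain ⟨s, hs⟩ := exists_seq (M := M) hn (fun a => ⌊P a * M⌋₊) (by
      have : ∑ a, ((⌊P a * M⌋₊ : ℕ) : ℝ) ≤ ∑ a, P a * M :=
        Finset.sum_le_sum fun a _ => Nat.floor_le (mul_nonneg (hP a) hM0'.le)
      rw [← Finset.sum_mul, hP1, one_mul] at this
      exact_mod_cast this)
    refine ⟨_, Finset.mem_image_of_mem _ (Finset.mem_univ s), ?_⟩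
    have key : ∀ a, 0 < P a → (2 : ℝ) ^ (-(ε / 2)) * P a ^ c ≤ smoothQ n M η s a := by
      intro a ha
      have hle1 : P a ≤ 1 := by
        rw [← hP1]; exact Finset.single_le_sum (fun b _ => hP b) (Finset.mem_univ a)
      rw [← hrr]
      unfold smoothQ
      have hcnt : P a * M - 1 ≤ ((Finset.univ.filter fun j => s j = a).card : ℝ) := by
        have h3 : ((⌊P a * M⌋₊ : ℕ) : ℝ) ≤ _ := Nat.cast_le.2 (hs a)
        have := Nat.lt_floor_add_one (P a * M)
        linarith
      set k : ℝ := ((Finset.univ.filter fun j => s j = a).card : ℝ)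
      have hk0 : 0 ≤ k := by positivity
      have h1η : 1 - η = r := by linarith
      rw [h1η]
      by_cases hh : η ≤ P a * x
      · have h4 : P a ^ c ≤ P a := by
          simpa using Real.rpow_le_rpow_of_exponent_ge ha hle1 hc
        have h5 : 1 ≤ η * (P a * M) := by
          calc (1 : ℝ) = η * (1 / η ^ 2 * η) := by field_simp
            _ ≤ η * (1 / η ^ 2 * (P a * x)) := by gcongr
            _ = η * (P a * (1 / η ^ 2 * x)) := by ring
            _ ≤ _ := by gcongr
        have h6 : r * P a ≤ k / M := by
          rw [le_div_iff₀ hM0']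
          have : r * P a * M = P a * M - η * (P a * M) := by rw [hη]; ring
          linarith
        calc r * r * P a ^ c ≤ r * r * P a := by gcongr
          _ = r * (r * P a) := by ring
          _ ≤ r * (k / M) := by gcongr
          _ ≤ _ := by have : 0 < η / n := by positivity
                      linarith
      · push Not at hh
        have h4 : P a ^ c * n ≤ η := by
          rw [← hxc, ← Real.mul_rpow ha.le hx0.le]
          calc (P a * x) ^ c ≤ η ^ c := by gcongr
            _ ≤ η := by simpa using Real.rpow_le_rpow_of_exponent_ge hη0 hη1.le hc
        have h5 : P a ^ c ≤ η / n := (le_div_iff₀ hn0).2 h4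
        have h6 : 0 ≤ P a ^ c := by positivity
        have h7 : r * r ≤ 1 := by nlinarith
        have h8 : 0 ≤ r * (k / M) := by positivity
        nlinarith
    have hsum : relEnt P (smoothQ n M η s) ≤
        ∑ a, ((c - 1) * (P a * Real.logb 2 (1 / P a)) + P a * (ε / 2)) := by
      apply Finset.sum_le_sum
      intro a _
      rcases (hP a).eq_or_lt with h | h
      · simp [← h]
      · have := mul_le_mul_of_nonneg_left (term_bound c ε _ _ h (key a h)) h.le
        linarith
    rw [Finset.sum_add_distrib, ← Finset.mul_sum, ← Finset.sum_mul, hP1] at hsum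
    unfold entropy
    linarith
end

section
/- Fix c ≥ 1 and ε > 0. There is a constant C (depending only on c and ε) such that for all m, n, ℓ there exists a finite set 𝒬 of ℓth-order Markov processes over {1,…,n}, with |𝒬| ≤ n^ℓ · 2^{C · n^{ℓ + 1/c} · log n}, such that for every string S ∈ {1,…,n}^m there is some Q ∈ 𝒬 that emits s_1⋯s_ℓ with probability 1 and satisfies log(1/Pr[Q emits S]) < (c · H_ℓ(S) + ε) m. -/
open scoped BigOperators

lemma exists_rounding {n M : ℕ} (hn : 0 < n) (k : Fin n → ℕ) (hk : ∑ a, k a ≤ M) :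
    ∃ f : Fin M → Fin n, ∀ a, k a ≤ (Finset.univ.filter fun i => f i = a).card := by
  have hcard : Fintype.card (Σ a, Fin (k a)) ≤ Fintype.card (Fin M) := by simpa using hk
  obtain ⟨e⟩ := Function.Embedding.nonempty_of_card_le hcard
  refine ⟨Function.extend e Sigma.fst (fun _ => ⟨0, hn⟩), fun a => ?_⟩
  have h := Finset.card_le_card_of_injOn (s := (Finset.univ : Finset (Fin (k a))))
    (t := Finset.univ.filter fun i => Function.extend e Sigma.fst (fun _ => (⟨0, hn⟩ : Fin n)) i = a)
    (fun j => e ⟨a, j⟩) (by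
      intro j _
      simp [e.injective.extend_apply]) (by
      intro x _ y _ hxy
      have := e.injective hxy
      simpa using this)
  simpa using h

noncomputable def mixDist (δ : ℝ) {n M : ℕ} (f : Fin M → Fin n) (a : Fin n) : ℝ :=
  δ / n + (1 - δ) * (((Finset.univ.filter fun i => f i = a).card : ℝ) / M)

lemma mixDist_pos {δ : ℝ} (h0 : 0 < δ) (h1 : δ < 1) {n M : ℕ} (hn : 0 < n) (f : Fin M → Fin n)
    (a : Fin n) : 0 < mixDist δ f a := by
  have : (0 : ℝ) < n := by exact_mod_cast hn
  have : (0 : ℝ) < 1 - δ := by linarith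
  unfold mixDist
  positivity

lemma mixDist_sum {δ : ℝ} {n M : ℕ} (hn : 0 < n) (hM : 0 < M) (f : Fin M → Fin n) :
    ∑ a, mixDist δ f a = 1 := by
  have hn' : (n : ℝ) ≠ 0 := by positivity
  have hM' : (M : ℝ) ≠ 0 := by positivity
  have hs : ∑ a, ((Finset.univ.filter fun i => f i = a).card : ℝ) = M := by
    have := Finset.card_eq_sum_card_fiberwise (s := (Finset.univ : Finset (Fin M)))
      (t := Finset.univ) (f := f) (by intro x _; simp)
    simp only [Finset.card_univ, Fintype.card_fin] at this
    exact_mod_cast this.symm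
  unfold mixDist
  rw [Finset.sum_add_distrib, ← Finset.mul_sum, ← Finset.sum_div (f := fun a => ((Finset.univ.filter fun i => f i = a).card : ℝ)), hs]
  simp only [Finset.sum_const, Finset.card_univ, Fintype.card_fin, nsmul_eq_mul]
  field_simp
  ring

lemma mixDist_cover {c δ : ℝ} (hc : 1 ≤ c) (h0 : 0 < δ) (h1 : δ < 1) {n M : ℕ} (hn : 0 < n)
    (hM : (n : ℝ) ^ (1 / c) / δ ^ 2 ≤ M) (P : Fin n → ℝ) (hP : ∀ a, 0 ≤ P a)
    (hs : ∑ a, P a = 1) :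
    ∃ f : Fin M → Fin n, ∀ a, (1 - δ) ^ 2 * P a ^ c ≤ mixDist δ f a := by
  have hn' : (0 : ℝ) < n := by exact_mod_cast hn
  have hd : (0 : ℝ) < 1 - δ := by linarith
  have hc0 : 0 < c := by linarith
  have hx : 0 < (n : ℝ) ^ (1 / c) := by positivity
  have hM0 : (0 : ℝ) < M := lt_of_lt_of_le (by positivity) hM
  obtain ⟨f, hf⟩ := exists_rounding (M := M) hn (fun a => ⌊(M : ℝ) * P a⌋₊) (by
    have : ((∑ a, ⌊(M : ℝ) * P a⌋₊ : ℕ) : ℝ) ≤ M := by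
      push_cast
      calc ∑ a, ((⌊(M : ℝ) * P a⌋₊ : ℕ) : ℝ) ≤ ∑ a, (M : ℝ) * P a :=
            Finset.sum_le_sum fun a _ => Nat.floor_le (mul_nonneg hM0.le (hP a))
        _ = M := by rw [← Finset.mul_sum, hs, mul_one]
    exact_mod_cast this)
  refine ⟨f, fun a => ?_⟩
  have hP1 : P a ≤ 1 := hs ▸ Finset.single_le_sum (fun b _ => hP b) (Finset.mem_univ a)
  set N : ℝ := ((Finset.univ.filter fun i => f i = a).card : ℝ) with hN
  have hN0 : 0 ≤ N := by positivity
  have hk : (M : ℝ) * P a - 1 ≤ N := by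
    have h2 : ((⌊(M : ℝ) * P a⌋₊ : ℕ) : ℝ) ≤ N := by
      rw [hN]; exact Nat.cast_le.2 (hf a)
    have := Nat.lt_floor_add_one ((M : ℝ) * P a)
    linarith
  have hq : mixDist δ f a = δ / n + (1 - δ) * (N / M) := rfl
  rw [hq]
  by_cases hb : δ ≤ P a * (n : ℝ) ^ (1 / c)
  · have hPc : P a ^ c ≤ P a := by
      have := Real.rpow_le_rpow_of_exponent_ge' (hP a) hP1 zero_le_one hc
      simpa using this
    have hMP : 1 ≤ δ * (M * P a) := by
      have h3 : (n : ℝ) ^ (1 / c) ≤ M * δ ^ 2 := by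
        rwa [div_le_iff₀ (by positivity)] at hM
      have h4 : δ ≤ P a * (M * δ ^ 2) := hb.trans (mul_le_mul_of_nonneg_left h3 (hP a))
      have h5 : δ * 1 ≤ δ * (δ * (M * P a)) := by nlinarith
      exact le_of_mul_le_mul_left h5 h0
    have hNM : (1 - δ) * P a ≤ N / M := by
      rw [le_div_iff₀ hM0]
      nlinarith
    have h6 : (1 - δ) * ((1 - δ) * P a) ≤ (1 - δ) * (N / M) :=
      mul_le_mul_of_nonneg_left hNM hd.le
    have h7 : (1 - δ) ^ 2 * P a ^ c ≤ (1 - δ) ^ 2 * P a :=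
      mul_le_mul_of_nonneg_left hPc (by positivity)
    have : 0 ≤ δ / n := by positivity
    nlinarith
  · push Not at hb
    have h2 : (P a * (n : ℝ) ^ (1 / c)) ^ c ≤ δ ^ c :=
      Real.rpow_le_rpow (mul_nonneg (hP a) hx.le) hb.le hc0.le
    rw [Real.mul_rpow (hP a) hx.le, ← Real.rpow_mul hn'.le, one_div_mul_cancel hc0.ne',
      Real.rpow_one] at h2
    have h3 : δ ^ c ≤ δ := by
      have := Real.rpow_le_rpow_of_exponent_ge' h0.le h1.le zero_le_one hc
      simpa using this
    have h4 : P a ^ c ≤ δ / n := by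
      rw [le_div_iff₀ hn']; linarith
    have h5 : 0 ≤ P a ^ c := Real.rpow_nonneg (hP a) c
    have h6 : (1 - δ) ^ 2 ≤ 1 := by nlinarith
    have h7 : 0 ≤ (1 - δ) * (N / M) := by positivity
    nlinarith

lemma sum_map_filterMap {A B : Type*} (g : A → Option B) (F : B → ℝ) (L : List A) :
    ((L.filterMap g).map F).sum = (L.map fun i => (g i).elim 0 F).sum := by
  induction L with
  | nil => simp
  | cons x L ih =>
    rcases h : g x with _ | y <;> simp [h, ih]

lemma list_sum_range (f : ℕ → ℝ) (m : ℕ) :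
    ((List.range m).map f).sum = ∑ i ∈ Finset.range m, f i := rfl

lemma sum_follow {n ℓ : ℕ} (d : Fin n) (S : List (Fin n)) (F : (Fin ℓ → Fin n) → Fin n → ℝ) :
    ∑ α : Fin ℓ → Fin n, ((follow (List.ofFn α) S).map (F α)).sum =
    ∑ i : Fin S.length, if ℓ ≤ (i : ℕ) then
      F (fun j => ((S.drop ((i : ℕ) - ℓ)).take ℓ).getD j d) (S.get i) else 0 := by
  set G : ℕ → ℝ := fun i => F (fun j => ((S.drop i).take ℓ).getD j d) (S.getD (i + ℓ) d) with hG
  have h1 : ∑ α : Fin ℓ → Fin n, ((follow (List.ofFn α) S).map (F α)).sum =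
      ∑ i ∈ Finset.range S.length, if i + ℓ < S.length then G i else 0 := by
    unfold follow
    simp only [sum_map_filterMap, List.length_ofFn, list_sum_range]
    rw [Finset.sum_comm]
    refine Finset.sum_congr rfl fun i hi => ?_
    split_ifs with h
    · have hl : ((S.drop i).take ℓ).length = ℓ := by simp; omega
      have hof : List.ofFn (fun j : Fin ℓ => ((S.drop i).take ℓ).getD j d) =
          (S.drop i).take ℓ := by
        apply List.ext_getElem
        · simp only [List.length_ofFn, hl]
        · intro k h1 h2
          rw [List.getElem_ofFn, List.getD_eq_getElem _ _ h2]
      rw [Finset.sum_eq_single (fun j : Fin ℓ => ((S.drop i).take ℓ).getD j d)]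
      · rw [if_pos hof.symm]
        have : (S.drop (i + ℓ)).head? = some (S.getD (i + ℓ) d) := by
          rw [List.head?_drop, List.getD_eq_getElem _ _ h, List.getElem?_eq_getElem h]
        rw [this]
        rfl
      · intro α _ hα
        rw [if_neg]
        · rfl
        · intro he
          exact hα (List.ofFn_injective (by rw [hof, he]))
      · simp
    · apply Finset.sum_eq_zero
      intro α _
      have : (S.drop (i + ℓ)).head? = none := by
        rw [List.head?_drop, List.getElem?_eq_none (by omega)]
      rw [this]
      simp
  have h2 : (∑ i : Fin S.length, if ℓ ≤ (i : ℕ) then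
      F (fun j => ((S.drop ((i : ℕ) - ℓ)).take ℓ).getD j d) (S.get i) else 0) =
      ∑ i ∈ Finset.range S.length, if ℓ ≤ i then G (i - ℓ) else 0 := by
    rw [Finset.sum_range]
    refine Finset.sum_congr rfl fun i _ => ?_
    split_ifs with h
    · simp only [hG]
      rw [Nat.sub_add_cancel h]
      simp
    · rfl
  rw [h1, h2, ← Finset.sum_filter, ← Finset.sum_filter]
  refine Finset.sum_bij' (fun i _ => i + ℓ) (fun i _ => i - ℓ) ?_ ?_ ?_ ?_ ?_ <;>
    simp <;> intros <;> omega

lemma length_mul_H0 {n : ℕ} (L : List (Fin n)) :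
    (L.map fun a => Real.logb 2 ((L.length : ℝ) / L.count a)).sum = L.length * H0 L := by
  rw [Finset.sum_list_map_count, H0, Finset.mul_sum]
  refine Finset.sum_congr rfl fun a ha => ?_
  have : (L.length : ℝ) ≠ 0 := by
    have := List.length_pos_of_mem (List.mem_toFinset.1 ha)
    positivity
  rw [nsmul_eq_mul]
  field_simp

lemma empEnt_mul {n ℓ m : ℕ} (hm : 0 < m) (S : List (Fin n)) (hS : S.length = m) :
    empEnt n ℓ S * m =
      ∑ α : Fin ℓ → Fin n, ((follow (List.ofFn α) S).length : ℝ) * H0 (follow (List.ofFn α) S) := by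
  unfold empEnt
  split_ifs with h
  · subst h
    have : follow [] S = S := by
      unfold follow
      apply List.ext_getElem?
      intro k
      clear hS
      induction S generalizing k with
      | nil => simp
      | cons x S ih =>
        rw [List.length_cons, List.range_succ_eq_map, List.filterMap_cons]
        rcases k with _ | k
        · simp
        · simpa [List.filterMap_map, Function.comp_def] using ih k
    simp [this, hS, mul_comm]
  · rw [hS]
    have : (m : ℝ) ≠ 0 := by positivity
    field_simp

/-- for fixed `c ≥ 1` and `ε > 0` there is a constant `C` such that for all
`m, n, ℓ` there is a set of at most `n^ℓ · 2^{C n^{ℓ+1/c} log n}` `ℓ`th-order Markov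
processes over `{1,…,n}` containing, for each string `S` of length `m`, some `Q`
(emitting `s_1⋯s_ℓ` with probability 1) with `log(1/Pr[Q emits S]) < (c H_ℓ(S) + ε) m`. -/
theorem statement3 (c ε : ℝ) (hc : 1 ≤ c) (hε : 0 < ε) :
    ∃ C : ℝ, 0 < C ∧ ∀ m n ℓ : ℕ, 0 < m → 0 < n →
      ∃ 𝒬 : Finset (MarkovProcess n ℓ),
        (𝒬.card : ℝ) ≤ (n : ℝ) ^ ℓ * 2 ^ (C * (n : ℝ) ^ ((ℓ : ℝ) + 1 / c) * Real.logb 2 n) ∧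
        ∀ S : List (Fin n), S.length = m →
          ∃ Q ∈ 𝒬, 0 < emitProb ℓ Q S ∧
            Real.logb 2 (1 / emitProb ℓ Q S) < (c * empEnt n ℓ S + ε) * m := by
  classical
  obtain ⟨t, ht0, ht1, htl⟩ : ∃ t : ℝ, 0 < t ∧ t < 1 ∧ Real.logb 2 t = -(ε / 4) :=
    ⟨2 ^ (-(ε / 4)), by positivity, Real.rpow_lt_one_of_one_lt_of_neg (by norm_num) (by linarith),
      Real.logb_rpow (by norm_num) (by norm_num)⟩
  have hc0 : 0 < c := by linarith
  set δ : ℝ := 1 - t with hδ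
  have h0 : 0 < δ := by linarith
  have h1 : δ < 1 := by linarith
  refine ⟨2 / δ ^ 2, by positivity, fun m n ℓ hm hn => ?_⟩
  have hn' : (0 : ℝ) < n := by exact_mod_cast hn
  have hn1 : (1 : ℝ) ≤ n := by exact_mod_cast hn
  set x : ℝ := (n : ℝ) ^ (1 / c) with hx
  have hx1 : 1 ≤ x := Real.one_le_rpow hn1 (by positivity)
  set M : ℕ := ⌈x / δ ^ 2⌉₊ with hM
  have hMl : x / δ ^ 2 ≤ M := Nat.le_ceil _
  have hxd : 1 ≤ x / δ ^ 2 := by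
    rw [le_div_iff₀ (by positivity)]; nlinarith
  have hMu : (M : ℝ) ≤ 2 / δ ^ 2 * x := by
    have := Nat.ceil_lt_add_one (a := x / δ ^ 2) (by positivity)
    have e : 2 / δ ^ 2 * x = x / δ ^ 2 + x / δ ^ 2 := by ring
    rw [e]; linarith
  have hM0 : 0 < M := by
    have : (0 : ℝ) < M := by linarith
    exact_mod_cast this
  let d : Fin n := ⟨0, hn⟩
  let mk : ((Fin ℓ → Fin n) → (Fin M → Fin n)) → MarkovProcess n ℓ := fun g =>
    { q := fun α => mixDist δ (g fun j => α.getD j d)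
      nonneg := fun α a => (mixDist_pos h0 h1 hn _ a).le
      sum_one := fun α _ => mixDist_sum hn hM0 _ }
  refine ⟨Finset.univ.image mk, ?_, ?_⟩
  · have hcard : ((Finset.univ.image mk).card : ℝ) ≤ ((n ^ M) ^ (n ^ ℓ) : ℕ) := by
      have := Finset.card_image_le (s := Finset.univ) (f := mk)
      simp only [Finset.card_univ, Fintype.card_fun, Fintype.card_fin] at this
      exact_mod_cast this
    have hlog : 0 ≤ Real.logb 2 n := Real.logb_nonneg (by norm_num) hn1
    have hpow : (((n ^ M) ^ (n ^ ℓ) : ℕ) : ℝ) = 2 ^ (((M : ℝ) * (n : ℝ) ^ ℓ) * Real.logb 2 n) := by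
      rw [mul_comm, Real.rpow_mul (by norm_num), Real.rpow_logb (by norm_num) (by norm_num) hn',
        ← pow_mul]
      push_cast
      rw [← Real.rpow_natCast]
      push_cast
      rfl
    have hle : (((n ^ M) ^ (n ^ ℓ) : ℕ) : ℝ) ≤
        2 ^ (2 / δ ^ 2 * (n : ℝ) ^ ((ℓ : ℝ) + 1 / c) * Real.logb 2 n) := by
      rw [hpow]
      apply Real.rpow_le_rpow_of_exponent_le (by norm_num)
      apply mul_le_mul_of_nonneg_right _ hlog
      rw [Real.rpow_add hn', Real.rpow_natCast, ← hx]
      calc (M : ℝ) * (n : ℝ) ^ ℓ ≤ 2 / δ ^ 2 * x * (n : ℝ) ^ ℓ := by gcongr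
        _ = _ := by ring
    have h2 : (1 : ℝ) ≤ (n : ℝ) ^ ℓ := one_le_pow₀ hn1
    refine (hcard.trans hle).trans ?_
    exact le_mul_of_one_le_left (by positivity) h2
  · intro S hS
    have hex : ∀ α : Fin ℓ → Fin n, ∃ f : Fin M → Fin n, ∀ a ∈ follow (List.ofFn α) S,
        - Real.logb 2 (mixDist δ f a) ≤
          c * Real.logb 2 (((follow (List.ofFn α) S).length : ℝ) /
            (follow (List.ofFn α) S).count a) + ε / 2 := by
      intro α
      generalize follow (List.ofFn α) S = L
      by_cases hL : L = []
      · subst hL; exact ⟨fun _ => d, by simp⟩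
      have hL0 : (0 : ℝ) < L.length := by
        have := List.length_pos_iff.2 hL
        exact_mod_cast this
      obtain ⟨f, hf⟩ := mixDist_cover hc h0 h1 hn hMl (fun a => (L.count a : ℝ) / L.length)
        (fun a => by positivity) (by
          rw [← Finset.sum_div, div_eq_one_iff_eq hL0.ne']
          have := Finset.sum_list_map_count L (fun _ => 1)
          have h3 : ∑ a, L.count a = L.length := by
            simp only [List.map_const', List.sum_replicate, smul_eq_mul, mul_one] at this
            rw [this]
            symm
            apply Finset.sum_subset (Finset.subset_univ _)
            intro a _ ha
            exact List.count_eq_zero.2 (by simpa using ha)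
          exact_mod_cast h3)
      refine ⟨f, fun a ha => ?_⟩
      have hca : (0 : ℝ) < L.count a := by exact_mod_cast List.count_pos_iff.2 ha
      have hp : (0 : ℝ) < (L.count a : ℝ) / L.length := by positivity
      have h4 := hf a
      have hpc := Real.rpow_pos_of_pos hp c
      have h5 : Real.logb 2 ((1 - δ) ^ 2 * ((L.count a : ℝ) / L.length) ^ c) ≤
          Real.logb 2 (mixDist δ f a) := by
        apply Real.logb_le_logb_of_le (by norm_num) _ h4
        have : 0 < 1 - δ := by linarith
        positivity
      have h6 : (1 - δ) = t := by rw [hδ]; ring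
      rw [h6, Real.logb_mul (by positivity) hpc.ne', Real.logb_pow, htl,
        Real.logb_rpow_eq_mul_logb_of_pos hp] at h5
      have h7 : Real.logb 2 ((L.length : ℝ) / L.count a) =
          - Real.logb 2 ((L.count a : ℝ) / L.length) := by
        rw [← Real.logb_inv, inv_div]
      rw [h7]
      push_cast at h5
      linarith
    choose g hg using hex
    have hterm : ∀ i : Fin S.length, 0 < (if ℓ ≤ (i : ℕ) then
        (mk g).q ((S.drop ((i : ℕ) - ℓ)).take ℓ) (S.get i) else 1) := by
      intro i
      split_ifs
      · exact mixDist_pos h0 h1 hn _ _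
      · norm_num
    have hpos : 0 < emitProb ℓ (mk g) S := Finset.prod_pos fun i _ => hterm i
    refine ⟨mk g, Finset.mem_image_of_mem _ (Finset.mem_univ g), hpos, ?_⟩
    have hlog : Real.logb 2 (1 / emitProb ℓ (mk g) S) =
        ∑ α : Fin ℓ → Fin n, ((follow (List.ofFn α) S).map
          (fun a => - Real.logb 2 (mixDist δ (g α) a))).sum := by
      rw [sum_follow d S (fun α a => - Real.logb 2 (mixDist δ (g α) a)), one_div, Real.logb_inv,
        emitProb, Real.logb_prod _ _ (fun i _ => (hterm i).ne'), ← Finset.sum_neg_distrib]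
      refine Finset.sum_congr rfl fun i _ => ?_
      split_ifs
      · rfl
      · simp
    have hlen : ∑ α : Fin ℓ → Fin n, ((follow (List.ofFn α) S).length : ℝ) ≤ m := by
      have h8 := sum_follow d S (fun (_ : Fin ℓ → Fin n) _ => (1 : ℝ))
      simp only [List.map_const', List.sum_replicate, nsmul_eq_mul, mul_one] at h8
      rw [h8]
      calc _ ≤ ∑ i : Fin S.length, (1 : ℝ) := Finset.sum_le_sum fun i _ => by
            split_ifs <;> norm_num
        _ = m := by simp [hS]
    have hm' : (0 : ℝ) < m := by exact_mod_cast hm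
    rw [hlog]
    calc _ ≤ ∑ α : Fin ℓ → Fin n, (c * (((follow (List.ofFn α) S).length : ℝ) *
            H0 (follow (List.ofFn α) S)) + ε / 2 * (follow (List.ofFn α) S).length) := by
          refine Finset.sum_le_sum fun α _ => ?_
          refine (List.sum_le_sum (hg α)).trans_eq ?_
          rw [← length_mul_H0, List.sum_map_add, List.sum_map_mul_left]
          simp [mul_comm]
      _ = c * (empEnt n ℓ S * m) + ε / 2 *
            ∑ α : Fin ℓ → Fin n, ((follow (List.ofFn α) S).length : ℝ) := by
          rw [empEnt_mul hm S hS, Finset.sum_add_distrib, Finset.mul_sum, Finset.mul_sum]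
      _ ≤ c * (empEnt n ℓ S * m) + ε / 2 * m := by gcongr
      _ < (c * empEnt n ℓ S + ε) * m := by nlinarith
end

section
/- Fix c ≥ 1 and ε > 0, and let ℓ and n be functions from the positive integers (string lengths m) to the positive integers such that n(m)^{ℓ(m) + 1/c} · log n(m) = o(m) as m → ∞. Then for all sufficiently large m there exists an injective encoding f from {1,…,n(m)}^m into finite binary strings such that every S ∈ {1,…,n(m)}^m satisfies |f(S)| < (c · H_{ℓ(m)}(S) + ε) m, where |f(S)| is the length in bits of the encoding of S. (Consequently the Kolmogorov complexity of every such S is less than (c · H_{ℓ(m)}(S) + ε) m.) -/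
open scoped BigOperators

lemma kraft_aux {X : Type*} [Fintype X] (w : X → ℝ) (hw : ∀ x, 0 < w x) (hs : ∑ x, w x ≤ 1) :
    ∃ f : X → List Bool, Function.Injective f ∧
      ∀ x, ((f x).length : ℝ) ≤ 1 + Real.logb 2 (1 / w x) := by
  classical
  let e := Fintype.equivFin X
  let u : Fin (Fintype.card X) → ℝ := fun i => - w (e.symm i)
  let σ := Tuple.sort u
  have hmono : Monotone (u ∘ σ) := Tuple.monotone_sort u
  let r : X → ℕ := fun x => (σ.symm (e x)).1
  have hr : Function.Injective r := by
    intro x y h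
    exact e.injective (σ.symm.injective (Fin.ext h))
  have hrank : ∀ x, (r x : ℝ) * w x ≤ 1 := by
    intro x
    let s : Finset X := Finset.univ.filter (fun y => r y < r x)
    have hcard : s.card = r x := by
      have : s.card = (Finset.range (r x)).card := by
        apply Finset.card_bij (fun y _ => r y)
        · intro y hy
          simpa [s] using hy
        · intro y _ z _ h
          exact hr h
        · intro b hb
          have hb' : b < r x := by simpa using hb
          have hlt : b < Fintype.card X := lt_trans hb' (σ.symm (e x)).2
          refine ⟨e.symm (σ ⟨b, hlt⟩), ?_, ?_⟩ <;> simp [s, r]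
          exact hb'
      simpa using this
    have h1 : (s.card : ℝ) * w x ≤ ∑ y ∈ s, w y := by
      rw [← nsmul_eq_mul]
      apply Finset.card_nsmul_le_sum
      intro y hy
      have hy' : r y < r x := by simpa [s] using hy
      have := hmono (show σ.symm (e y) ≤ σ.symm (e x) from le_of_lt hy')
      simpa [u] using this
    have h2 : ∑ y ∈ s, w y ≤ ∑ y, w y :=
      Finset.sum_le_sum_of_subset_of_nonneg (Finset.subset_univ _) (fun y _ _ => (hw y).le)
    rw [hcard] at h1
    linarith
  have hw1 : ∀ x, w x ≤ 1 := fun x =>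
    (Finset.single_le_sum (f := w) (fun y _ => (hw y).le) (Finset.mem_univ x)).trans hs
  refine ⟨fun x => Nat.bits (r x), ?_, ?_⟩
  · intro x y h
    apply hr
    have h' : Nat.bits (r x) = Nat.bits (r y) := h
    have := congrArg (fun l : List Bool => l.foldr (fun b k => Nat.bit b k) 0) h'
    have key : ∀ k : ℕ, (Nat.bits k).foldr (fun b k => Nat.bit b k) 0 = k := by
      intro k
      induction k using Nat.binaryRec' with
      | zero => simp
      | bit b k hk ih => rw [Nat.bits_append_bit _ _ hk]; simp [ih]
    simpa [key] using this
  · intro x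
    show ((Nat.bits (r x)).length : ℝ) ≤ _
    rw [Nat.size_eq_bits_len]
    have hnn : 0 ≤ Real.logb 2 (1 / w x) :=
      Real.logb_nonneg (by norm_num) (by rw [le_div_iff₀ (hw x)]; linarith [hw1 x])
    rcases Nat.eq_zero_or_pos (r x) with h0 | h0
    · rw [h0]; simp; simpa using add_nonneg zero_le_one hnn
    · have hsz : 0 < Nat.size (r x) := Nat.size_pos.2 h0
      have h2 : 2 ^ (Nat.size (r x) - 1) ≤ r x := by
        apply Nat.lt_size.1; omega
      have h3 : ((2:ℝ) ^ (Nat.size (r x) - 1)) ≤ 1 / w x := by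
        rw [le_div_iff₀ (hw x)]
        refine le_trans ?_ (hrank x)
        apply mul_le_mul_of_nonneg_right _ (hw x).le
        exact_mod_cast h2
      have h4 : ((Nat.size (r x) - 1 : ℕ) : ℝ) ≤ Real.logb 2 (1 / w x) := by
        rw [Real.le_logb_iff_rpow_le (by norm_num) (by have := hw x; positivity)]
        simpa [Real.rpow_natCast] using h3
      have h5 : (Nat.size (r x) : ℝ) = 1 + ((Nat.size (r x) - 1 : ℕ) : ℝ) := by
        rw [Nat.cast_sub (by omega)]; simp
      linarith

/-- weight of a string given history-dependent kernel -/
noncomputable def Wt {A : Type*} (κ : List A → A → ℝ) : List A → List A → ℝ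
  | _, [] => 1
  | h, a :: t => κ h a * Wt κ (h ++ [a]) t

lemma Wt_sum {A : Type*} [Fintype A] (κ : List A → A → ℝ)
    (hκ : ∀ h, ∑ a, κ h a = 1) (m : ℕ) : ∀ h : List A,
    ∑ v : Fin m → A, Wt κ h (List.ofFn v) = 1 := by
  induction m with
  | zero => intro h; simp [Wt]
  | succ m ih =>
    intro h
    rw [← (Fin.consEquiv (fun _ : Fin (m+1) => A)).sum_comp, Fintype.sum_prod_type]
    simp only [Fin.consEquiv, Equiv.coe_fn_mk, List.ofFn_cons, Wt]
    simp_rw [← Finset.mul_sum, ih, mul_one, hκ]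

lemma Wt_pos {A : Type*} (κ : List A → A → ℝ) (hκ : ∀ h a, 0 < κ h a) (S : List A) :
    ∀ h, 0 < Wt κ h S := by
  induction S with
  | nil => intro h; simp [Wt]
  | cons a t ih => intro h; exact mul_pos (hκ _ _) (ih _)

lemma Wt_log {A : Type*} (κ : List A → A → ℝ) (hκ : ∀ h a, 0 < κ h a) (d : A) (S : List A) :
    ∀ h, Real.logb 2 (1 / Wt κ h S) =
      ∑ i ∈ Finset.range S.length, Real.logb 2 (1 / κ (h ++ S.take i) (S.getD i d)) := by
  induction S with
  | nil => intro h; simp [Wt]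
  | cons a t ih =>
    intro h
    have h1 := hκ h a
    have h2 := Wt_pos κ hκ t (h ++ [a])
    rw [List.length_cons, Finset.sum_range_succ', Wt]
    simp only [List.take_succ_cons, List.getD_cons_succ, List.take_zero, List.append_nil,
      List.getD_cons_zero]
    have := ih (h ++ [a])
    simp only [List.append_assoc, List.singleton_append] at this
    rw [← this, ← Real.logb_mul (by positivity) (by positivity)]
    congr 1
    field_simp

lemma exists_fibers {n M : ℕ} (hn : 0 < n) (k : Fin n → ℕ) (hk : ∑ a, k a ≤ M) :
    ∃ g : Fin M → Fin n, ∀ a, k a ≤ (Finset.univ.filter (fun i => g i = a)).card := by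
  classical
  have hc : Fintype.card (Σ a : Fin n, Fin (k a)) ≤ Fintype.card (Fin M) := by simpa using hk
  obtain ⟨e⟩ := Function.Embedding.nonempty_of_card_le hc
  refine ⟨Function.extend e Sigma.fst (fun _ => ⟨0, hn⟩), fun a => ?_⟩
  calc k a = (Finset.univ : Finset (Fin (k a))).card := by simp
    _ ≤ _ := by
      apply Finset.card_le_card_of_injOn (fun j => e ⟨a, j⟩)
      · intro j _
        simp [e.injective.extend_apply]
      · intro i _ j _ h
        have := e.injective h
        simpa using this

/-- distribution from a sample -/
noncomputable def qd {n M : ℕ} (δ : ℝ) (g : Fin M → Fin n) (a : Fin n) : ℝ :=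
  (1 - δ) * ((Finset.univ.filter (fun i => g i = a)).card : ℝ) / M + δ / n

lemma qd_sum {n M : ℕ} (hn : 0 < n) (hM : 0 < M) (δ : ℝ) (g : Fin M → Fin n) :
    ∑ a, qd δ g a = 1 := by
  unfold qd
  have h : ∑ a, ((Finset.univ.filter (fun i => g i = a)).card : ℝ) = M := by
    have := Finset.card_eq_sum_card_fiberwise (f := g) (s := Finset.univ) (t := Finset.univ)
      (fun _ _ => Finset.mem_coe.2 (Finset.mem_univ _))
    rw [← Nat.cast_sum, ← this]; simp
  rw [Finset.sum_add_distrib, ← Finset.sum_div, ← Finset.mul_sum, h]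
  simp
  field_simp
  ring

lemma qd_pos {n M : ℕ} (hn : 0 < n) (δ : ℝ) (hδ : 0 < δ) (hδ1 : δ < 1) (g : Fin M → Fin n)
    (a : Fin n) : 0 < qd δ g a := by
  unfold qd
  have : 0 < 1 - δ := by linarith
  positivity

lemma quant {n M : ℕ} (hn : 0 < n) (hM : 0 < M) (c δ : ℝ) (hc : 1 ≤ c) (hδ : 0 < δ) (hδ1 : δ < 1)
    (hMb : (1 / δ) * ((n : ℝ) / δ) ^ (1 / c) ≤ M) (T : List (Fin n)) :
    ∃ g : Fin M → Fin n, ∀ a ∈ T, Real.logb 2 (1 / qd δ g a) ≤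
      c * Real.logb 2 ((T.length : ℝ) / T.count a) + 2 * Real.logb 2 (1 / (1 - δ)) := by
  have hd : 0 < 1 - δ := by linarith
  rcases Nat.eq_zero_or_pos T.length with hL | hL
  · refine ⟨fun _ => ⟨0, hn⟩, ?_⟩
    have : T = [] := List.length_eq_zero_iff.1 hL
    simp [this]
  have hcount : ∑ a, T.count a = T.length := by
    simpa using List.sum_toFinset_count_eq_length T ▸
      (Finset.sum_subset (Finset.subset_univ T.toFinset) (f := fun a => T.count a)
      (fun a _ h => by simpa [List.count_eq_zero] using h)).symm
  obtain ⟨g, hg⟩ := exists_fibers (M := M) hn (fun a => T.count a * M / T.length) (by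
    have h : (∑ a, T.count a * M / T.length) * T.length ≤ M * T.length := by
      rw [Finset.sum_mul]
      calc _ ≤ ∑ a, T.count a * M := Finset.sum_le_sum (fun a _ => Nat.div_mul_le_self _ _)
        _ = _ := by rw [← Finset.sum_mul, hcount, mul_comm]
    exact Nat.le_of_mul_le_mul_right h hL)
  refine ⟨g, fun a ha => ?_⟩
  have hca : 0 < T.count a := List.count_pos_iff.2 ha
  have hcL : T.count a ≤ T.length := List.count_le_length
  set L : ℝ := (T.length : ℝ) with hLdef
  have hL' : 0 < L := Nat.cast_pos.2 hL
  set p : ℝ := (T.count a : ℝ) / L with hp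
  have hp0 : 0 < p := by have : (0:ℝ) < T.count a := by exact_mod_cast hca
                         positivity
  have hp1 : p ≤ 1 := by rw [hp, div_le_one hL', hLdef]; exact_mod_cast hcL
  have hinv : L / T.count a = 1 / p := by rw [hp, one_div_div]
  rw [hinv]
  have hq := qd_pos hn δ hδ hδ1 g a
  have hM' : (0:ℝ) < M := by exact_mod_cast hM
  have hn' : (0:ℝ) < n := by exact_mod_cast hn
  have hl1 : 0 ≤ Real.logb 2 (1 / (1 - δ)) :=
    Real.logb_nonneg (by norm_num) (by rw [le_div_iff₀ hd]; linarith)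
  have hl2 : 0 ≤ Real.logb 2 (1 / p) :=
    Real.logb_nonneg (by norm_num) (by rw [le_div_iff₀ hp0]; linarith)
  by_cases hcase : (δ / n) ^ (1 / c) ≤ p
  · -- heavy
    have h1 : 1 ≤ δ * p * M := by
      have hx : ((n:ℝ) / δ) ^ (1 / c) * (δ / n) ^ (1 / c) = 1 := by
        rw [← Real.mul_rpow (by positivity) (by positivity)]
        rw [show (n:ℝ) / δ * (δ / n) = 1 by field_simp, Real.one_rpow]
      calc (1:ℝ) = δ * (δ / n) ^ (1 / c) * ((1 / δ) * ((n : ℝ) / δ) ^ (1 / c)) := by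
            rw [show δ * (δ / n) ^ (1 / c) * ((1 / δ) * ((n : ℝ) / δ) ^ (1 / c)) =
              (δ * (1/δ)) * (((n:ℝ) / δ) ^ (1 / c) * (δ / n) ^ (1 / c)) by ring, hx]
            field_simp
        _ ≤ δ * p * M := by gcongr
    have h2 : p * M - 1 ≤ ((Finset.univ.filter (fun i => g i = a)).card : ℝ) := by
      have h3 : p * M < ((T.count a * M / T.length : ℕ) : ℝ) + 1 := by
        rw [hp, div_mul_eq_mul_div, div_lt_iff₀ hL', hLdef]
        exact_mod_cast (by
          have := Nat.lt_div_mul_add (a := T.count a * M) hL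
          nlinarith : T.count a * M < (T.count a * M / T.length + 1) * T.length)
      have h4 : ((T.count a * M / T.length : ℕ) : ℝ) ≤
        ((Finset.univ.filter (fun i => g i = a)).card : ℝ) := by exact_mod_cast hg a
      linarith
    have h5 : (1 - δ) * ((1 - δ) * p) ≤ qd δ g a := by
      unfold qd
      have : (1 - δ) * p ≤ ((Finset.univ.filter (fun i => g i = a)).card : ℝ) / M := by
        rw [le_div_iff₀ hM']; nlinarith
      have h6 := mul_le_mul_of_nonneg_left this hd.le
      rw [mul_div_assoc]
      have : 0 < δ / n := by positivity
      linarith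
    calc Real.logb 2 (1 / qd δ g a) ≤ Real.logb 2 (1 / ((1 - δ) * ((1 - δ) * p))) := by
          apply Real.logb_le_logb_of_le (by norm_num) (by positivity)
          apply one_div_le_one_div_of_le (by positivity) h5
      _ = Real.logb 2 (1 / p) + 2 * Real.logb 2 (1 / (1 - δ)) := by
          rw [show 1 / ((1 - δ) * ((1 - δ) * p)) = (1/p) * ((1/(1-δ)) * (1/(1-δ))) by field_simp]
          rw [Real.logb_mul (by positivity) (by positivity),
            Real.logb_mul (by positivity) (by positivity)]
          ring
      _ ≤ _ := by nlinarith
  · push Not at hcase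
    have h1 : p ^ c ≤ δ / n := by
      calc p ^ c ≤ ((δ / n) ^ (1 / c)) ^ c :=
            Real.rpow_le_rpow hp0.le hcase.le (by linarith)
        _ = δ / n := by
            rw [← Real.rpow_mul (by positivity)]
            rw [one_div, inv_mul_cancel₀ (by linarith), Real.rpow_one]
    have h2 : p ^ c ≤ qd δ g a := by
      refine h1.trans ?_
      unfold qd
      have : 0 ≤ (1 - δ) * ((Finset.univ.filter (fun i => g i = a)).card : ℝ) / M := by positivity
      linarith
    have h3 : 0 < p ^ c := Real.rpow_pos_of_pos hp0 c
    calc Real.logb 2 (1 / qd δ g a) ≤ Real.logb 2 (1 / p ^ c) := by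
          apply Real.logb_le_logb_of_le (by norm_num) (by positivity)
          apply one_div_le_one_div_of_le h3 h2
      _ = c * Real.logb 2 (1 / p) := by
          rw [one_div, one_div, Real.logb_inv, Real.logb_inv, Real.logb_rpow_eq_mul_logb_of_pos hp0]
          ring
      _ ≤ _ := by linarith

lemma H0_sum {A : Type*} [DecidableEq A] (T : List A) (c η : ℝ) :
    (T.map (fun a => c * Real.logb 2 ((T.length : ℝ) / T.count a) + η)).sum =
      c * (T.length * H0 T) + η * T.length := by
  rcases Nat.eq_zero_or_pos T.length with hL | hL
  · have : T = [] := List.length_eq_zero_iff.1 hL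
    simp [this]
  have hL' : (0:ℝ) < T.length := Nat.cast_pos.2 hL
  rw [List.sum_map_add]
  congr 1
  · rw [Finset.sum_list_map_count, H0, Finset.mul_sum, Finset.mul_sum]
    apply Finset.sum_congr rfl
    intro a _
    rw [nsmul_eq_mul]
    field_simp
  · simp [mul_comm]

/-- the last `ℓ` characters of a history, padded by a default -/
def ctx {A : Type*} (d : A) (ℓ : ℕ) (h : List A) : Fin ℓ → A :=
  fun j => h.getD (h.length - ℓ + j) d

lemma sum_filterMap {A : Type*} (F : ℕ → Option A) (φ : A → ℝ) (N : ℕ) :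
    (((List.range N).filterMap F).map φ).sum = ∑ i ∈ Finset.range N, (F i).elim 0 φ := by
  induction N with
  | zero => simp
  | succ N ih =>
    rw [List.range_succ, List.filterMap_append, List.map_append, List.sum_append, ih,
      Finset.sum_range_succ]
    congr 1
    cases h : F N <;> simp [h]

lemma ctx_eq {A : Type*} (d : A) (ℓ : ℕ) (S : List A) (i : ℕ) (hi : i + ℓ < S.length)
    (α : Fin ℓ → A) : (S.drop i).take ℓ = List.ofFn α ↔ α = ctx d ℓ (S.take (i + ℓ)) := by
  have key : (S.drop i).take ℓ = List.ofFn (ctx d ℓ (S.take (i + ℓ))) := by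
    apply List.ext_getElem
    · simp; omega
    · intro j h1 h2
      have hj : j < ℓ := by simpa using h2
      have hm : min (i + ℓ) S.length - ℓ = i := by omega
      simp only [List.getElem_take, List.getElem_drop, List.getElem_ofFn, ctx, List.length_take, hm]
      rw [List.getD_eq_getElem _ _ (by simp; omega)]
      simp
  rw [key]
  constructor
  · intro h; exact (List.ofFn_injective h).symm
  · intro h; rw [h]

lemma regroup {A : Type*} [DecidableEq A] [Fintype A] (d : A) (ℓ : ℕ) (S : List A)
    (φ : (Fin ℓ → A) → A → ℝ) :
    ∑ α : Fin ℓ → A, ((follow (List.ofFn α) S).map (φ α)).sum =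
      ∑ i ∈ Finset.range S.length,
        if ℓ ≤ i then φ (ctx d ℓ (S.take i)) (S.getD i d) else 0 := by
  unfold follow
  simp_rw [sum_filterMap, List.length_ofFn]
  rw [Finset.sum_comm]
  have h1 : ∀ i ∈ Finset.range S.length,
      ∑ α : Fin ℓ → A, (if (S.drop i).take ℓ = List.ofFn α then (S.drop (i + ℓ)).head?
        else none).elim 0 (φ α) =
      if i + ℓ < S.length then φ (ctx d ℓ (S.take (i + ℓ))) (S.getD (i + ℓ) d) else 0 := by
    intro i _
    split_ifs with h
    · rw [Finset.sum_eq_single (ctx d ℓ (S.take (i + ℓ)))]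
      · rw [if_pos ((ctx_eq d ℓ S i h _).2 rfl), List.head?_drop, List.getElem?_eq_getElem h,
          List.getD_eq_getElem _ _ h]
        rfl
      · intro α _ hα
        rw [if_neg (fun hh => hα ((ctx_eq d ℓ S i h _).1 hh))]
        rfl
      · intro hh; exact absurd (Finset.mem_univ _) hh
    · apply Finset.sum_eq_zero
      intro α _
      rw [List.head?_drop, List.getElem?_eq_none (by omega)]
      simp
  rw [Finset.sum_congr rfl h1, ← Finset.sum_filter, ← Finset.sum_filter]
  apply Finset.sum_bij (fun i _ => i + ℓ)
  · intro i hi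
    simp at hi ⊢
    omega
  · intro i _ j _ h
    omega
  · intro b hb
    simp at hb
    exact ⟨b - ℓ, by simp; omega, by omega⟩
  · intro i _
    rfl

/-- the kernel of the model -/
noncomputable def ker {n M : ℕ} (d : Fin n) (ℓ : ℕ) (δ : ℝ)
    (g : (Fin ℓ → Fin n) → Fin M → Fin n) (h : List (Fin n)) (a : Fin n) : ℝ :=
  if ℓ ≤ h.length then qd δ (g (ctx d ℓ h)) a else 1 / n

lemma coding {n M m ℓ : ℕ} (hℓ : 0 < ℓ) (hm : 0 < m) (hn : 0 < n) (hM : 0 < M) (c δ : ℝ)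
    (hc : 1 ≤ c) (hδ : 0 < δ) (hδ1 : δ < 1)
    (hMb : (1 / δ) * ((n : ℝ) / δ) ^ (1 / c) ≤ M) :
    ∃ f : {S : List (Fin n) // S.length = m} → List Bool, Function.Injective f ∧
      ∀ S : {S : List (Fin n) // S.length = m}, ((f S).length : ℝ) ≤
        1 + (n:ℝ) ^ ℓ * M * Real.logb 2 n + ℓ * Real.logb 2 n + c * (empEnt n ℓ S.1 * m)
          + 2 * Real.logb 2 (1 / (1 - δ)) * m := by
  classical
  have hn' : (0:ℝ) < n := Nat.cast_pos.2 hn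
  have hm' : (0:ℝ) < m := Nat.cast_pos.2 hm
  have hd : 0 < 1 - δ := by linarith
  set η := 2 * Real.logb 2 (1 / (1 - δ)) with hη
  have hη0 : 0 ≤ η := by
    have : 0 ≤ Real.logb 2 (1 / (1 - δ)) :=
      Real.logb_nonneg (by norm_num) (by rw [le_div_iff₀ hd]; linarith)
    positivity
  have hlogn : 0 ≤ Real.logb 2 n := Real.logb_nonneg (by norm_num) (by exact_mod_cast hn)
  let d : Fin n := ⟨0, hn⟩
  choose q hq using quant (M := M) hn hM c δ hc hδ hδ1 hMb
  let G := (Fin ℓ → Fin n) → Fin M → Fin n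
  let gS : List (Fin n) → G := fun S α => q (follow (List.ofFn α) S)
  have hkpos : ∀ (g : G) h a, 0 < ker d ℓ δ g h a := by
    intro g h a
    unfold ker
    split_ifs
    · exact qd_pos hn δ hδ hδ1 _ _
    · positivity
  have hksum : ∀ (g : G) h, ∑ a, ker d ℓ δ g h a = 1 := by
    intro g h
    unfold ker
    split_ifs
    · exact qd_sum hn hM δ _
    · simp; field_simp
  have hGpos : (0:ℝ) < Fintype.card G := by
    have : Nonempty G := ⟨gS []⟩
    exact_mod_cast Fintype.card_pos
  let w : (Fin m → Fin n) → ℝ := fun v =>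
    Wt (ker d ℓ δ (gS (List.ofFn v))) [] (List.ofFn v) / Fintype.card G
  have hwpos : ∀ v, 0 < w v := fun v => div_pos (Wt_pos _ (hkpos _) _ _) hGpos
  have hwsum : ∑ v, w v ≤ 1 := by
    calc ∑ v, w v ≤ ∑ v : Fin m → Fin n, ∑ g : G,
          Wt (ker d ℓ δ g) [] (List.ofFn v) / Fintype.card G := by
          apply Finset.sum_le_sum
          intro v _
          exact Finset.single_le_sum (f := fun g : G =>
            Wt (ker d ℓ δ g) [] (List.ofFn v) / Fintype.card G)
            (fun g _ => (div_pos (Wt_pos _ (hkpos g) _ _) hGpos).le) (Finset.mem_univ _)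
      _ = 1 := by
          rw [Finset.sum_comm]
          simp_rw [← Finset.sum_div, Wt_sum _ (hksum _)]
          simp only [Finset.sum_const, Finset.card_univ, nsmul_eq_mul, mul_one]
          exact div_self hGpos.ne'
  obtain ⟨f, hf, hfl⟩ := kraft_aux w hwpos hwsum
  let toV : {S : List (Fin n) // S.length = m} → (Fin m → Fin n) :=
    fun S i => S.1.get (i.cast S.2.symm)
  have htoV : ∀ S, List.ofFn (toV S) = S.1 := by
    rintro ⟨S, rfl⟩
    exact List.ofFn_get S
  refine ⟨fun S => f (toV S), ?_, ?_⟩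
  · intro S T h
    have := hf h
    apply Subtype.ext
    rw [← htoV S, ← htoV T, this]
  · intro S
    refine (hfl (toV S)).trans ?_
    have hw : w (toV S) = Wt (ker d ℓ δ (gS S.1)) [] S.1 / Fintype.card G := by
      simp only [w, htoV]
    obtain ⟨S, hS⟩ := S
    simp only at hw ⊢
    have hWp := Wt_pos _ (hkpos (gS S)) S []
    rw [hw, one_div_div, ← mul_one_div, Real.logb_mul hGpos.ne' (by positivity),
      Wt_log _ (hkpos _) d]
    have hcard : Real.logb 2 (Fintype.card G) = (n:ℝ) ^ ℓ * M * Real.logb 2 n := by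
      have : Fintype.card G = n ^ (M * n ^ ℓ) := by
        simp [G, ← pow_mul]
      rw [this, Nat.cast_pow, Real.logb_pow]
      push_cast
      ring
    have hsplit : ∑ i ∈ Finset.range S.length,
          Real.logb 2 (1 / ker d ℓ δ (gS S) ([] ++ S.take i) (S.getD i d)) =
        (∑ i ∈ Finset.range S.length, if ℓ ≤ i then
          Real.logb 2 (1 / qd δ (gS S (ctx d ℓ (S.take i))) (S.getD i d)) else 0) +
        ∑ i ∈ Finset.range S.length, if i < ℓ then Real.logb 2 n else 0 := by
      rw [← Finset.sum_add_distrib]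
      apply Finset.sum_congr rfl
      intro i hi
      have hi' : i < S.length := Finset.mem_range.1 hi
      unfold ker
      have : ([] ++ S.take i).length = i := by simp; omega
      rw [this]
      by_cases h : ℓ ≤ i
      · simp [h, not_lt.2 h]
      · simp [h, not_le.1 h]
    have hpre : (∑ i ∈ Finset.range S.length, if i < ℓ then Real.logb 2 (n:ℝ) else 0) ≤
        ℓ * Real.logb 2 n := by
      rw [← Finset.sum_filter, Finset.sum_const, nsmul_eq_mul]
      gcongr
      calc _ ≤ (Finset.range ℓ).card := by
            apply Finset.card_le_card
            intro i hi
            simp at hi ⊢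
            exact hi.2
        _ = ℓ := by simp
    have hlen : ∑ α : Fin ℓ → Fin n, ((follow (List.ofFn α) S).length : ℝ) ≤ m := by
      have := regroup d ℓ S (fun _ _ => (1:ℝ))
      simp only [List.map_const', List.sum_replicate, nsmul_eq_mul, mul_one] at this
      rw [this]
      calc _ ≤ ∑ i ∈ Finset.range S.length, (1:ℝ) := by
            apply Finset.sum_le_sum
            intro i _
            split_ifs <;> norm_num
        _ = m := by simp [hS]
    have hmain : (∑ i ∈ Finset.range S.length, if ℓ ≤ i then
          Real.logb 2 (1 / qd δ (gS S (ctx d ℓ (S.take i))) (S.getD i d)) else 0) ≤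
        c * (empEnt n ℓ S * m) + η * m := by
      rw [← regroup d ℓ S (fun α a => Real.logb 2 (1 / qd δ (gS S α) a))]
      calc _ ≤ ∑ α : Fin ℓ → Fin n, (c * ((follow (List.ofFn α) S).length *
              H0 (follow (List.ofFn α) S)) + η * (follow (List.ofFn α) S).length) := by
            apply Finset.sum_le_sum
            intro α _
            rw [← H0_sum]
            apply List.sum_le_sum
            intro a ha
            exact hq _ a ha
        _ = c * (empEnt n ℓ S * m) +
            η * ∑ α : Fin ℓ → Fin n, ((follow (List.ofFn α) S).length : ℝ) := by
            rw [Finset.sum_add_distrib, ← Finset.mul_sum, ← Finset.mul_sum, empEnt,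
              if_neg hℓ.ne', hS]
            field_simp
        _ ≤ _ := by gcongr
    rw [hsplit, hcard]
    linarith

/-- fix `c ≥ 1`, `ε > 0`, and functions `ℓ, n` to the positive integers with
`n(m)^{ℓ(m)+1/c} log n(m) = o(m)`. Then for all sufficiently large `m` there is an
injective encoding `f` of the length-`m` strings over `{1,…,n(m)}` into binary strings
such that `|f(S)| < (c H_{ℓ(m)}(S) + ε) m` for every such string `S`. -/
theorem statement4 (c ε : ℝ) (hc : 1 ≤ c) (hε : 0 < ε) (ℓ n : ℕ → ℕ)
    (hℓ : ∀ m, 0 < ℓ m) (hn : ∀ m, 0 < n m)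
    (ho : Filter.Tendsto
      (fun m : ℕ => (n m : ℝ) ^ ((ℓ m : ℝ) + 1 / c) * Real.logb 2 (n m) / m)
      Filter.atTop (nhds 0)) :
    ∃ m₀ : ℕ, ∀ m ≥ m₀,
      ∃ f : {S : List (Fin (n m)) // S.length = m} → List Bool,
        Function.Injective f ∧
        ∀ S : {S : List (Fin (n m)) // S.length = m},
          ((f S).length : ℝ) < (c * empEnt (n m) (ℓ m) S.1 + ε) * m := by
  set δ : ℝ := 1 - (2:ℝ) ^ (-(ε / 4)) with hδdef
  have h2 : 0 < (2:ℝ) ^ (-(ε / 4)) := by positivity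
  have h2' : (2:ℝ) ^ (-(ε / 4)) < 1 :=
    Real.rpow_lt_one_of_one_lt_of_neg (by norm_num) (by linarith)
  have hδ : 0 < δ := by linarith
  have hδ1 : δ < 1 := by linarith
  have hη : 2 * Real.logb 2 (1 / (1 - δ)) = ε / 2 := by
    rw [show 1 - δ = (2:ℝ) ^ (-(ε / 4)) by rw [hδdef]; ring, one_div, Real.logb_inv,
      Real.logb_rpow (by norm_num) (by norm_num)]
    ring
  set C : ℝ := (1 / δ) * (1 / δ) ^ (1 / c) + 2 with hC
  have hCpos : 0 < C := by positivity
  have hev := (ho.eventually (gt_mem_nhds (show (0:ℝ) < ε / (8 * C) by positivity)))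
  obtain ⟨m₁, hm₁⟩ := Filter.eventually_atTop.1 hev
  obtain ⟨m₂, hm₂⟩ := exists_nat_gt (8 / ε)
  refine ⟨max (max m₁ m₂) 1, fun m hm => ?_⟩
  have hma : m₁ ≤ m := by omega
  have hmb : m₂ ≤ m := by omega
  have hm0 : 0 < m := by omega
  have hm0' : (0:ℝ) < m := Nat.cast_pos.2 hm0
  have hN : (1:ℝ) ≤ n m := by exact_mod_cast hn m
  have hN0 : (0:ℝ) < n m := by linarith
  have hsmall := hm₁ m hma
  rw [div_lt_iff₀ hm0'] at hsmall
  have hbig : 8 < ε * m := by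
    have : (m₂:ℝ) ≤ m := by exact_mod_cast hmb
    have h8 := lt_of_lt_of_le hm₂ this
    rw [div_lt_iff₀ hε] at h8
    linarith
  set x : ℝ := (1 / δ) * ((n m : ℝ) / δ) ^ (1 / c) with hx
  have hxpos : 0 < x := by positivity
  obtain ⟨f, hf, hfl⟩ := coding (M := ⌈x⌉₊) (hℓ m) hm0 (hn m) (Nat.ceil_pos.2 hxpos) c δ hc hδ hδ1
    (Nat.le_ceil x)
  refine ⟨f, hf, fun S => lt_of_le_of_lt (hfl S) ?_⟩
  rw [hη]
  have hc0 : 0 ≤ 1 / c := by positivity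
  have hp1 : 1 ≤ (n m : ℝ) ^ (1 / c) := Real.one_le_rpow hN hc0
  have hM : (⌈x⌉₊ : ℝ) ≤ (C - 1) * (n m : ℝ) ^ (1 / c) := by
    have h1 := (Nat.ceil_lt_add_one hxpos.le).le
    have h3 : x = (1 / δ) * (1 / δ) ^ (1 / c) * (n m : ℝ) ^ (1 / c) := by
      rw [hx, div_eq_mul_one_div (n m : ℝ) δ, Real.mul_rpow (by positivity) (by positivity)]
      ring
    rw [hC]
    linarith
  have hlogn : 0 ≤ Real.logb 2 (n m) := Real.logb_nonneg (by norm_num) hN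
  set P : ℝ := (n m : ℝ) ^ ((ℓ m : ℝ) + 1 / c) with hP
  have hPe : P = (n m : ℝ) ^ (ℓ m) * (n m : ℝ) ^ (1 / c) := by
    rw [hP, Real.rpow_add hN0, Real.rpow_natCast]
  have t1 : (n m : ℝ) ^ (ℓ m) * ⌈x⌉₊ ≤ (C - 1) * P := by
    calc _ ≤ (n m : ℝ) ^ (ℓ m) * ((C - 1) * (n m : ℝ) ^ (1 / c)) := by gcongr
      _ = _ := by rw [hPe]; ring
  have t2 : (ℓ m : ℝ) * Real.logb 2 (n m) ≤ P * Real.logb 2 (n m) := by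
    rcases Nat.lt_or_ge (n m) 2 with h | h
    · have : n m = 1 := by have := hn m; omega
      simp [this]
    · apply mul_le_mul_of_nonneg_right _ hlogn
      have h3 : (ℓ m : ℝ) ≤ (n m : ℝ) ^ (ℓ m) := by
        exact_mod_cast (Nat.lt_pow_self (by omega : 1 < n m)).le
      rw [hPe]
      exact h3.trans (le_mul_of_one_le_right (by positivity) hp1)
  have t3 := mul_le_mul_of_nonneg_right t1 hlogn
  have t4 : C * (P * Real.logb 2 (n m)) ≤ ε * m / 8 := by
    have := mul_le_mul_of_nonneg_left hsmall.le hCpos.le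
    refine this.trans_eq ?_
    field_simp
  nlinarith
end

section
/- Let ℓ ≥ 1, let n, m satisfy n^ℓ > ℓ, let S = s_1⋯s_m be chosen uniformly at random from {1,…,n}^m, fix α ∈ {1,…,n}^ℓ, and define binary random variables X_1,…,X_{m−ℓ} by X_i = 1 iff s_i⋯s_{i+ℓ−1} = α and s_{i+ℓ} does not occur in α. Then for every i with ℓ+1 ≤ i ≤ m−ℓ, X_i is independent of X_1,…,X_{i−ℓ−1}; if any of X_{i−ℓ},…,X_{i−1} equals 1 then X_i = 0; and Pr[ X_i = 1 | X_{i−ℓ} = ⋯ = X_{i−1} = 0 ] ≤ 1/(n^ℓ − ℓ). -/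
open scoped BigOperators

theorem Xvar_eq_one_iff {n m ℓ : ℕ} (α : Fin ℓ → Fin n) (i : ℕ) (h : i + ℓ < m)
    (S : Fin m → Fin n) : Xvar ℓ α i S = 1 ↔
      (∀ j : ℕ, ∀ hj : j < ℓ, S ⟨i + j, by omega⟩ = α ⟨j, hj⟩) ∧
        (∀ j : Fin ℓ, α j ≠ S ⟨i + ℓ, h⟩) := by
  unfold Xvar
  rw [dif_pos h]
  constructor
  · intro h1
    split_ifs at h1 with h2
    exact ⟨fun j hj => h2.1 ⟨j, hj⟩, h2.2⟩
  · intro h1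
    exact if_pos ⟨fun j => h1.1 j.1 j.2, h1.2⟩

theorem Xvar_zero_or_one {n m ℓ : ℕ} (α : Fin ℓ → Fin n) (i : ℕ)
    (S : Fin m → Fin n) : Xvar ℓ α i S = 0 ∨ Xvar ℓ α i S = 1 := by
  unfold Xvar
  split_ifs <;> simp

theorem Xvar_congr {n m ℓ : ℕ} (α : Fin ℓ → Fin n) (i : ℕ)
    (S T : Fin m → Fin n) (h : ∀ j : Fin m, i ≤ j.1 → j.1 ≤ i + ℓ → S j = T j) :
    Xvar ℓ α i S = Xvar ℓ α i T := by
  by_cases him : i + ℓ < m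
  · have : Xvar ℓ α i S = 1 ↔ Xvar ℓ α i T = 1 := by
      rw [Xvar_eq_one_iff α i him, Xvar_eq_one_iff α i him]
      rw [h ⟨i + ℓ, him⟩ (by simp) (by simp)]
      apply and_congr_left'
      apply forall_congr'; intro j
      apply forall_congr'; intro hj
      rw [h ⟨i + j, by omega⟩ (by simp) (by simp; omega)]
    rcases Xvar_zero_or_one α i S with h1 | h1 <;> rcases Xvar_zero_or_one α i T with h2 | h2 <;>
      simp_all
  · simp [Xvar, him]

theorem Xvar_part_one {n m : ℕ} (i : ℕ) (P Q : (Fin m → Fin n) → Prop)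
    (hP : ∀ S T : Fin m → Fin n, (∀ j : Fin m, i ≤ j.1 → S j = T j) → (P S ↔ P T))
    (hQ : ∀ S T : Fin m → Fin n, (∀ j : Fin m, j.1 < i → S j = T j) → (Q S ↔ Q T)) :
    Nat.card {S // P S ∧ Q S} * n ^ m = Nat.card {S // P S} * Nat.card {S // Q S} := by
  have hn : n ^ m = Nat.card (Fin m → Fin n) := by simp
  rw [hn, ← Nat.card_prod, ← Nat.card_prod]
  let g : (Fin m → Fin n) → (Fin m → Fin n) → (Fin m → Fin n) :=
    fun S T j => if j.1 < i then S j else T j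
  have gP : ∀ S T, P (g S T) ↔ P T := fun S T => hP _ _ (fun j hj => by simp [g]; omega)
  have gQ : ∀ S T, Q (g S T) ↔ Q S := fun S T => hQ _ _ (fun j hj => by simp [g]; omega)
  have gg : ∀ S T U V, g (g S T) (g U V) = g S V := by
    intro S T U V; funext j; simp only [g]; split_ifs <;> rfl
  have g1 : ∀ S, g S S = S := by intro S; funext j; simp [g]
  refine Nat.card_congr
    ⟨fun p => (⟨g p.2 p.1.1, (gP _ _).2 p.1.2.1⟩, ⟨g p.1.1 p.2, (gQ _ _).2 p.1.2.2⟩),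
     fun p => (⟨g p.2.1 p.1.1, (gP _ _).2 p.1.2, (gQ _ _).2 p.2.2⟩, g p.1.1 p.2.1), ?_, ?_⟩
  · rintro ⟨⟨S, hS⟩, T⟩
    simp [gg, g1]
  · rintro ⟨⟨S, hS⟩, ⟨T, hT⟩⟩
    simp [gg, g1]

theorem Xvar_card_shift {n m ℓ : ℕ} (α : Fin ℓ → Fin n) (i k : ℕ) (hk : k ≤ i)
    (him : i + ℓ < m) :
    Nat.card {S : Fin m → Fin n // Xvar ℓ α k S = 1} =
      Nat.card {S : Fin m → Fin n // Xvar ℓ α i S = 1} := by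
  haveI : NeZero m := ⟨by omega⟩
  let c : Fin m := ⟨i - k, by omega⟩
  symm
  refine Nat.card_congr (Equiv.subtypeEquiv
    (Equiv.arrowCongr (Equiv.addRight c).symm (Equiv.refl _)) ?_)
  intro S
  have key : ∀ j (hj : j ≤ ℓ), (⟨k + j, by omega⟩ : Fin m) + c = ⟨i + j, by omega⟩ := by
    intro j hj
    ext
    simp only [Fin.val_add, c]
    rw [Nat.mod_eq_of_lt (by omega)]
    omega
  rw [Xvar_eq_one_iff α i him, Xvar_eq_one_iff α k (by omega)]
  simp only [Equiv.arrowCongr_apply, Equiv.symm_symm, Function.comp, Equiv.coe_addRight,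
    Equiv.refl_apply]
  rw [key ℓ le_rfl]
  apply and_congr_left'
  apply forall_congr'; intro j
  apply forall_congr'; intro hj
  rw [key j hj.le]

theorem Xvar_card_bound {n m ℓ : ℕ} (α : Fin ℓ → Fin n) (i : ℕ) (him : i + ℓ < m) :
    Nat.card {S : Fin m → Fin n // Xvar ℓ α i S = 1} * n ^ ℓ ≤ n ^ m := by
  have hn : n ^ m = Nat.card (Fin m → Fin n) := by simp
  have hn' : n ^ ℓ = Nat.card (Fin ℓ → Fin n) := by simp
  rw [hn, hn', ← Nat.card_prod]
  refine Nat.card_le_card_of_injective (fun p j =>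
    if h : i ≤ j.1 ∧ j.1 < i + ℓ then p.2 ⟨j.1 - i, by omega⟩ else p.1.1 j) ?_
  rintro ⟨⟨S, hS⟩, β⟩ ⟨⟨T, hT⟩, γ⟩ h
  simp only at h
  rw [Xvar_eq_one_iff α i him] at hS hT
  have h1 : S = T := by
    funext j
    by_cases hj : i ≤ j.1 ∧ j.1 < i + ℓ
    · have e : j = ⟨i + (j.1 - i), by omega⟩ := by ext; simp; omega
      rw [e, hS.1 _ (by omega), hT.1 _ (by omega)]
    · have := congrFun h j
      simpa [hj] using this
  have h2 : β = γ := by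
    funext j
    have := congrFun h ⟨i + j.1, by omega⟩
    simpa using this
  subst h1 h2
  rfl

/-- for a uniformly random string `S ∈ {1,…,n}^m` and a fixed `α` of length
`ℓ ≥ 1` with `n^ℓ > ℓ`, with `X_i` the indicator that `α` occurs at position `i` followed
by a character not occurring in `α` (0-indexed, `ℓ ≤ i`, `i + ℓ < m`): `X_i` is
independent of `X_0, …, X_{i−ℓ−1}`; if any of `X_{i−ℓ}, …, X_{i−1}` equals 1 then
`X_i = 0`; and `Pr[X_i = 1 | X_{i−ℓ} = ⋯ = X_{i−1} = 0] ≤ 1/(n^ℓ − ℓ)` (in the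
cross-multiplied form `Pr[X_i = 1 ∧ B] · (n^ℓ − ℓ) ≤ Pr[B]`). -/
theorem statement8 {n m ℓ : ℕ} (hℓ : 1 ≤ ℓ) (hnl : ℓ < n ^ ℓ)
    (α : Fin ℓ → Fin n) (i : ℕ) (hi : ℓ ≤ i) (him : i + ℓ < m) :
    (∀ (x : ℕ) (b : ℕ → ℕ),
      Nat.card {S : Fin m → Fin n //
          Xvar ℓ α i S = x ∧ ∀ k < i - ℓ, Xvar ℓ α k S = b k} * n ^ m =
        Nat.card {S : Fin m → Fin n // Xvar ℓ α i S = x} *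
          Nat.card {S : Fin m → Fin n // ∀ k < i - ℓ, Xvar ℓ α k S = b k}) ∧
    (∀ (S : Fin m → Fin n) (k : ℕ), i - ℓ ≤ k → k < i →
      Xvar ℓ α k S = 1 → Xvar ℓ α i S = 0) ∧
    Nat.card {S : Fin m → Fin n //
        Xvar ℓ α i S = 1 ∧ ∀ k, i - ℓ ≤ k → k < i → Xvar ℓ α k S = 0} * (n ^ ℓ - ℓ) ≤
      Nat.card {S : Fin m → Fin n // ∀ k, i - ℓ ≤ k → k < i → Xvar ℓ α k S = 0} := by
  have part2 : ∀ (S : Fin m → Fin n) (k : ℕ), i - ℓ ≤ k → k < i →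
      Xvar ℓ α k S = 1 → Xvar ℓ α i S = 0 := by
    intro S k hk hki h1
    rcases Xvar_zero_or_one α i S with h0 | h0
    · exact h0
    · exfalso
      rw [Xvar_eq_one_iff α i him] at h0
      rw [Xvar_eq_one_iff α k (by omega)] at h1
      have h2 := h0.1 (k + ℓ - i) (by omega)
      apply h1.2 ⟨k + ℓ - i, by omega⟩
      rw [← h2]
      congr 2
      omega
  refine ⟨?_, part2, ?_⟩
  · intro x b
    apply Xvar_part_one i
    · intro S T h
      rw [Xvar_congr α i S T (fun j hj _ => h j hj)]
    · intro S T h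
      apply forall_congr'; intro k
      apply forall_congr'; intro hk
      rw [Xvar_congr α k S T (fun j hj hj' => h j (by omega))]
  · classical
    set N := Nat.card {S : Fin m → Fin n // Xvar ℓ α i S = 1} with hN
    have hle : Nat.card {S : Fin m → Fin n //
        Xvar ℓ α i S = 1 ∧ ∀ k, i - ℓ ≤ k → k < i → Xvar ℓ α k S = 0} ≤ N :=
      Nat.card_le_card_of_injective (fun p => ⟨p.1, p.2.1⟩) (by
        rintro ⟨S, hS⟩ ⟨T, hT⟩ h
        simpa using h)
    have hbound : N * n ^ ℓ ≤ n ^ m := Xvar_card_bound α i him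
    have hcover : n ^ m ≤ Nat.card {S : Fin m → Fin n //
        ∀ k, i - ℓ ≤ k → k < i → Xvar ℓ α k S = 0} + ℓ * N := by
      have hU : (Finset.univ : Finset (Fin m → Fin n)) ⊆
          (Finset.univ.filter fun S => ∀ k, i - ℓ ≤ k → k < i → Xvar ℓ α k S = 0) ∪
          (Finset.Ico (i - ℓ) i).biUnion fun k =>
            Finset.univ.filter fun S : Fin m → Fin n => Xvar ℓ α k S = 1 := by
        intro S _
        by_cases hB : ∀ k, i - ℓ ≤ k → k < i → Xvar ℓ α k S = 0
        · exact Finset.mem_union_left _ (by simpa using hB)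
        · apply Finset.mem_union_right
          push Not at hB
          obtain ⟨k, h1, h2, h3⟩ := hB
          rw [Finset.mem_biUnion]
          refine ⟨k, Finset.mem_Ico.2 ⟨h1, h2⟩, ?_⟩
          simpa using (Xvar_zero_or_one α k S).resolve_left h3
      have h1 := (Finset.card_le_card hU).trans (Finset.card_union_le _ _)
      have h2 : ((Finset.Ico (i - ℓ) i).biUnion fun k =>
            Finset.univ.filter fun S : Fin m → Fin n => Xvar ℓ α k S = 1).card ≤
            (Finset.Ico (i - ℓ) i).card * N := by
        apply Finset.card_biUnion_le_card_mul
        intro k hk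
        rw [Finset.mem_Ico] at hk
        rw [hN, ← Xvar_card_shift α i k (by omega) him, Nat.card_eq_fintype_card,
          Fintype.card_subtype]
      have h3 : (Finset.Ico (i - ℓ) i).card = ℓ := by simp; omega
      rw [h3] at h2
      rw [Nat.card_eq_fintype_card, Fintype.card_subtype]
      have h4 : (Finset.univ : Finset (Fin m → Fin n)).card = n ^ m := by simp
      rw [h4] at h1
      omega
    refine (Nat.mul_le_mul_right _ hle).trans ?_
    rw [Nat.mul_sub, Nat.mul_comm N ℓ]
    omega
end

section
/- Fix c ≥ 1, ε with 0 < ε < 1/c, and ℓ ≥ 1, and let n be a function from m to the positive integers with n(m)^{ℓ + 1/c − ε} = Ω(m). There is an m_0 such that for all m ≥ m_0 the following holds: if S is chosen uniformly at random from {1,…,n}^m, then for every α ∈ {1,…,n}^ℓ, Pr[ |{a : a ∈ S_α and a does not occur in α}| ≥ n^{1/c − 2ε/3} − ℓ ] ≤ 1 / 2^{n^{ε/3} − ℓ}. -/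
open scoped BigOperators

/-- positions where `α` occurs followed by a character outside `α` -/
def GoodPos {n m : ℕ} (ℓ : ℕ) (α : Fin ℓ → Fin n) (S : Fin m → Fin n) (i : Fin m) : Prop :=
  ∃ h : i.1 + ℓ < m, (∀ j : Fin ℓ, S ⟨i.1 + j.1, by have := j.2; omega⟩ = α j) ∧
    ∀ j : Fin ℓ, α j ≠ S ⟨i.1 + ℓ, h⟩

lemma card_agree {m n : ℕ} (P : Finset (Fin m)) (S0 : Fin m → Fin n) :
    (Finset.univ.filter (fun S : Fin m → Fin n => ∀ p ∈ P, S p = S0 p)).card ≤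
      n ^ (m - P.card) := by
  classical
  have h : (Finset.univ : Finset ({p : Fin m // p ∉ P} → Fin n)).card = n ^ (m - P.card) := by
    rw [Finset.card_univ, Fintype.card_fun, Fintype.card_fin]
    congr 1
    rw [Fintype.card_subtype_compl]
    simp
  rw [← h]
  apply Finset.card_le_card_of_injOn (fun S p => S p.1)
  · intro S _
    simp
  · intro S hS S' hS' he
    simp only [Finset.coe_filter, Finset.mem_univ, true_and, Set.mem_ofPred_eq] at hS hS'
    funext p
    by_cases hp : p ∈ P
    · rw [hS p hp, hS' p hp]
    · exact congrFun he ⟨p, hp⟩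

lemma good_sep {n m ℓ : ℕ} {α : Fin ℓ → Fin n} {S : Fin m → Fin n} {i i' : Fin m}
    (h : GoodPos ℓ α S i) (h' : GoodPos ℓ α S i') (hlt : i.1 < i'.1) : i.1 + ℓ < i'.1 := by
  by_contra hcon
  obtain ⟨h1, h2, h3⟩ := h
  obtain ⟨h1', h2', h3'⟩ := h'
  have hj : i.1 + ℓ - i'.1 < ℓ := by omega
  have := h2' ⟨i.1 + ℓ - i'.1, hj⟩
  apply h3 ⟨i.1 + ℓ - i'.1, hj⟩
  rw [← this]
  congr 1
  ext
  simp only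
  omega

open Classical in
lemma card_T {m n ℓ : ℕ} (α : Fin ℓ → Fin n) (T : Finset (Fin m)) :
    (Finset.univ.filter (fun S : Fin m → Fin n => ∀ i ∈ T, GoodPos ℓ α S i)).card
      * n ^ (ℓ * T.card) ≤ n ^ m := by
  by_cases hne : ∃ S0 : Fin m → Fin n, ∀ i ∈ T, GoodPos ℓ α S0 i
  · obtain ⟨S0, hS0⟩ := hne
    let f : {i // i ∈ T} × Fin ℓ → Fin m := fun q =>
      ⟨q.1.1.1 + q.2.1, by
        obtain ⟨h, _⟩ := hS0 q.1.1 q.1.2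
        have := q.2.2
        omega⟩
    have hf : Function.Injective f := by
      rintro ⟨⟨i, hi⟩, j⟩ ⟨⟨i', hi'⟩, j'⟩ he
      have he' : i.1 + j.1 = i'.1 + j'.1 := congrArg Fin.val he
      have hj := j.2
      have hj' := j'.2
      have hii : i = i' := by
        rcases lt_trichotomy i.1 i'.1 with h | h | h
        · have := good_sep (hS0 i hi) (hS0 i' hi') h
          omega
        · exact Fin.ext h
        · have := good_sep (hS0 i' hi') (hS0 i hi) h
          omega
      subst hii
      have : j = j' := Fin.ext (by omega)
      subst this
      rfl
    let P : Finset (Fin m) := Finset.univ.image f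
    have hP : P.card = ℓ * T.card := by
      rw [Finset.card_image_of_injective _ hf, Finset.card_univ, Fintype.card_prod,
        Fintype.card_coe, Fintype.card_fin, mul_comm]
    have hPm : P.card ≤ m := by simpa using Finset.card_le_univ P
    have hsub : (Finset.univ.filter (fun S : Fin m → Fin n => ∀ i ∈ T, GoodPos ℓ α S i)) ⊆
        Finset.univ.filter (fun S : Fin m → Fin n => ∀ p ∈ P, S p = S0 p) := by
      intro S hS
      simp only [Finset.mem_filter, Finset.mem_univ, true_and] at hS ⊢
      intro p hp
      obtain ⟨⟨⟨i, hi⟩, j⟩, _, rfl⟩ := Finset.mem_image.1 hp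
      obtain ⟨_, h2, _⟩ := hS i hi
      obtain ⟨_, h2', _⟩ := hS0 i hi
      exact (h2 j).trans (h2' j).symm
    calc _ ≤ n ^ (m - P.card) * n ^ (ℓ * T.card) := by
            gcongr
            refine le_trans (Finset.card_le_card hsub) (le_trans (le_of_eq ?_) (card_agree P S0))
            congr
      _ = n ^ m := by rw [← hP, ← pow_add]; congr 1; omega
  · have : (Finset.univ.filter (fun S : Fin m → Fin n => ∀ i ∈ T, GoodPos ℓ α S i)) = ∅ := by
      apply Finset.filter_eq_empty_iff.2
      intro S _ hS
      exact hne ⟨S, hS⟩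
    rw [this]
    simp

open Classical in
lemma follow_card {m n ℓ : ℕ} (α : Fin ℓ → Fin n) (S : Fin m → Fin n) :
    ((follow (List.ofFn α) (List.ofFn S)).toFinset.filter
      (fun a => a ∉ List.ofFn α)).card ≤ (Finset.univ.filter (GoodPos ℓ α S)).card := by
  let g : Fin m → Option (Fin n) := fun i => (List.ofFn S)[i.1 + ℓ]?
  have hsub : ((follow (List.ofFn α) (List.ofFn S)).toFinset.filter
      (fun a => a ∉ List.ofFn α)).image some ⊆ (Finset.univ.filter (GoodPos ℓ α S)).image g := by
    intro b hb
    obtain ⟨a, ha, rfl⟩ := Finset.mem_image.1 hb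
    rw [Finset.mem_filter, List.mem_toFinset] at ha
    obtain ⟨ha1, ha2⟩ := ha
    unfold follow at ha1
    rw [List.mem_filterMap] at ha1
    obtain ⟨i, hi, hif⟩ := ha1
    split_ifs at hif with hocc
    rw [List.mem_range, List.length_ofFn] at hi
    rw [List.head?_drop, List.length_ofFn] at hif
    rw [List.length_ofFn] at hocc
    have hlt : i + ℓ < m := by
      obtain ⟨h, _⟩ := List.getElem?_eq_some_iff.1 hif
      simpa using h
    have hSa : S ⟨i + ℓ, hlt⟩ = a := by
      obtain ⟨h, h'⟩ := List.getElem?_eq_some_iff.1 hif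
      simpa using h'
    refine Finset.mem_image.2 ⟨⟨i, hi⟩, ?_, hif⟩
    simp only [Finset.mem_filter, Finset.mem_univ, true_and]
    refine ⟨hlt, ?_, ?_⟩
    · intro j
      have := congrArg (fun L => L[j.1]?) hocc
      have hij : i + j.1 < m := by have := j.2; omega
      simpa [List.getElem?_take, List.getElem?_drop, List.getElem?_ofFn, hij] using this
    · intro j hj
      apply ha2
      rw [← hSa]
      change _ = S ⟨i + ℓ, hlt⟩ at hj
      rw [← hj, List.mem_ofFn]
      exact ⟨j, rfl⟩
  calc _ = _ := (Finset.card_image_of_injective _ (Option.some_injective _)).symm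
    _ ≤ _ := Finset.card_le_card hsub
    _ ≤ _ := Finset.card_image_le

open Classical in
lemma union_bound {m n ℓ : ℕ} (α : Fin ℓ → Fin n) (k : ℕ) :
    (Finset.univ.filter (fun S : Fin m → Fin n =>
      k ≤ ((follow (List.ofFn α) (List.ofFn S)).toFinset.filter
      (fun a => a ∉ List.ofFn α)).card)).card * n ^ (ℓ * k) ≤ m.choose k * n ^ m := by
  have hsub : (Finset.univ.filter (fun S : Fin m → Fin n =>
      k ≤ ((follow (List.ofFn α) (List.ofFn S)).toFinset.filter
      (fun a => a ∉ List.ofFn α)).card)) ⊆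
      (Finset.powersetCard k (Finset.univ : Finset (Fin m))).biUnion (fun T =>
        Finset.univ.filter (fun S : Fin m → Fin n => ∀ i ∈ T, GoodPos ℓ α S i)) := by
    intro S hS
    have hS' := (Finset.mem_filter.1 hS).2
    obtain ⟨T, hT, hTk⟩ := Finset.exists_subset_card_eq (hS'.trans (follow_card α S))
    refine Finset.mem_biUnion.2 ⟨T, Finset.mem_powersetCard.2 ⟨Finset.subset_univ _, hTk⟩, ?_⟩
    simp only [Finset.mem_filter, Finset.mem_univ, true_and]
    intro i hi
    exact (Finset.mem_filter.1 (hT hi)).2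
  calc _ ≤ (∑ T ∈ Finset.powersetCard k (Finset.univ : Finset (Fin m)),
        (Finset.univ.filter (fun S : Fin m → Fin n => ∀ i ∈ T, GoodPos ℓ α S i)).card)
          * n ^ (ℓ * k) := by
        gcongr
        exact (Finset.card_le_card hsub).trans Finset.card_biUnion_le
    _ ≤ ∑ T ∈ Finset.powersetCard k (Finset.univ : Finset (Fin m)), n ^ m := by
        rw [Finset.sum_mul]
        apply Finset.sum_le_sum
        intro T hT
        rw [← (Finset.mem_powersetCard.1 hT).2]
        exact card_T α T
    _ = _ := by simp

/-- fix `c ≥ 1`, `0 < ε < 1/c`, `ℓ ≥ 1`, and `n(m)` with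
`n(m)^{ℓ+1/c−ε} = Ω(m)`. For all sufficiently large `m`, for a uniformly random string
`S ∈ {1,…,n}^m` and every `α ∈ {1,…,n}^ℓ`,
`Pr[|{a ∈ S_α : a does not occur in α}| ≥ n^{1/c−2ε/3} − ℓ] ≤ 1/2^{n^{ε/3}−ℓ}`. -/
theorem statement9 (c ε : ℝ) (hc : 1 ≤ c) (hε : 0 < ε) (hεc : ε < 1 / c)
    (ℓ : ℕ) (hℓ : 1 ≤ ℓ) (n : ℕ → ℕ) (hn : ∀ m, 0 < n m)
    (hΩ : ∃ C : ℝ, 0 < C ∧ ∃ m₁ : ℕ, ∀ m ≥ m₁,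
      C * m ≤ (n m : ℝ) ^ ((ℓ : ℝ) + 1 / c - ε)) :
    ∃ m₀ : ℕ, ∀ m ≥ m₀, ∀ α : Fin ℓ → Fin (n m),
      (Nat.card {S : Fin m → Fin (n m) //
          (n m : ℝ) ^ ((1 : ℝ) / c - 2 * ε / 3) - ℓ ≤
            (((follow (List.ofFn α) (List.ofFn S)).toFinset.filter
              (fun a => a ∉ List.ofFn α)).card : ℝ)} : ℝ) / (n m : ℝ) ^ m ≤
        1 / (2 : ℝ) ^ ((n m : ℝ) ^ (ε / 3) - ℓ) := by
  classical
  obtain ⟨C, hC, m₁, hm₁⟩ := hΩ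
  have hβ : 0 < (ℓ : ℝ) + 1 / c - ε := by
    have : (0 : ℝ) ≤ ℓ := Nat.cast_nonneg _
    linarith
  have htend : Filter.Tendsto (fun m => (n m : ℝ)) Filter.atTop Filter.atTop := by
    rw [Filter.tendsto_atTop]
    intro b
    have h1 : Filter.Tendsto (fun m : ℕ => C * (m : ℝ)) Filter.atTop Filter.atTop :=
      tendsto_natCast_atTop_atTop.const_mul_atTop hC
    filter_upwards [h1.eventually_gt_atTop (b ^ ((ℓ : ℝ) + 1 / c - ε)),
      Filter.eventually_ge_atTop m₁] with m hm hmm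
    by_contra hcon
    push Not at hcon
    have h2 := Real.rpow_le_rpow (Nat.cast_nonneg (n m)) hcon.le hβ.le
    have h3 := hm₁ m hmm
    linarith
  have hx : 0 < 1 / c - 2 * ε / 3 := by linarith
  have e1 := ((tendsto_rpow_atTop hx).comp htend).eventually_ge_atTop (2 * (ℓ : ℝ))
  have e2 := ((tendsto_rpow_atTop (by linarith : 0 < ε / 3)).comp htend).eventually_ge_atTop
    (4 * Real.exp 1 / C)
  obtain ⟨m₀, hm₀⟩ := Filter.eventually_atTop.1
    ((e1.and e2).and (Filter.eventually_ge_atTop m₁))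
  refine ⟨m₀, fun m hm α => ?_⟩
  obtain ⟨⟨h1, h2⟩, h3⟩ := hm₀ m hm
  simp only [Function.comp] at h1 h2
  have hΩm := hm₁ m h3
  have hN1 : (1 : ℝ) ≤ (n m : ℝ) := by exact_mod_cast hn m
  have hub := fun k => union_bound (m := m) α k
  have hcard : ∀ k : ℕ, k = ⌈(n m : ℝ) ^ ((1 : ℝ) / c - 2 * ε / 3) - ℓ⌉₊ →
      Nat.card {S : Fin m → Fin (n m) //
          (n m : ℝ) ^ ((1 : ℝ) / c - 2 * ε / 3) - ℓ ≤
            (((follow (List.ofFn α) (List.ofFn S)).toFinset.filter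
              (fun a => a ∉ List.ofFn α)).card : ℝ)} = (Finset.univ.filter (fun S : Fin m → Fin (n m) =>
      k ≤ ((follow (List.ofFn α) (List.ofFn S)).toFinset.filter
      (fun a => a ∉ List.ofFn α)).card)).card := by
    rintro k rfl
    rw [Nat.card_eq_fintype_card, Fintype.card_subtype]
    congr 1
    ext S
    simp only [Finset.mem_filter, Finset.mem_univ, true_and, Nat.ceil_le]
  obtain ⟨k, hk⟩ : ∃ k : ℕ, k = ⌈(n m : ℝ) ^ ((1 : ℝ) / c - 2 * ε / 3) - ℓ⌉₊ := ⟨_, rfl⟩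
  rw [hcard k hk]
  have hubk := hub k
  clear hub hcard
  have hkx : (n m : ℝ) ^ ((1 : ℝ) / c - 2 * ε / 3) - ℓ ≤ k := hk ▸ Nat.le_ceil _
  generalize (Finset.univ.filter (fun S : Fin m → Fin (n m) =>
      k ≤ ((follow (List.ofFn α) (List.ofFn S)).toFinset.filter
      (fun a => a ∉ List.ofFn α)).card)).card = A at hubk ⊢
  generalize hNdef : (n m : ℝ) = N at *
  have hN0 : 0 < N := by linarith
  set x := N ^ ((1 : ℝ) / c - 2 * ε / 3) with hxdef
  have hxpos : 0 < x := Real.rpow_pos_of_pos hN0 _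
  have hk2 : x / 2 ≤ k := by linarith
  have hkpos : (0 : ℝ) < k := by linarith
  have hubR : (A : ℝ) * N ^ (ℓ * k) ≤ m.choose k * N ^ m := by
    rw [← hNdef]; exact_mod_cast hubk
  -- the ratio bound
  have hy : (m : ℝ) * (4 * Real.exp 1) ≤ x * N ^ ℓ := by
    have e : N ^ ((ℓ : ℝ) + 1 / c - ε) * N ^ (ε / 3) = x * N ^ ℓ := by
      rw [hxdef, ← Real.rpow_natCast N ℓ, ← Real.rpow_add hN0, ← Real.rpow_add hN0]
      congr 1; ring
    rw [← e]
    calc (m : ℝ) * (4 * Real.exp 1) = (C * m) * (4 * Real.exp 1 / C) := by field_simp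
      _ ≤ _ := by
        apply mul_le_mul hΩm h2 (by positivity) (by positivity)
  have hy2 : (m : ℝ) * Real.exp 1 * 2 ≤ k * N ^ ℓ := by
    have : x / 2 * N ^ ℓ ≤ k * N ^ ℓ := by gcongr
    linarith
  have hpow : ((m : ℝ) * Real.exp 1 * 2) ^ k ≤ (k * N ^ ℓ) ^ k := by gcongr
  have hfact : (k : ℝ) ^ k ≤ Real.exp 1 ^ k * k.factorial := by
    have := Real.pow_div_factorial_le_exp (k : ℝ) hkpos.le k
    rw [div_le_iff₀ (by positivity)] at this
    rwa [← Real.exp_nat_mul, mul_one]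
  have hch : (m.choose k : ℝ) * k.factorial ≤ (m : ℝ) ^ k := by
    have := Nat.choose_le_pow_div (α := ℝ) k m
    rwa [le_div_iff₀ (by positivity)] at this
  have hfin : (m.choose k : ℝ) * 2 ^ k ≤ N ^ (ℓ * k) := by
    have e0 : 0 < Real.exp 1 ^ k * (k.factorial : ℝ) := by positivity
    refine le_of_mul_le_mul_right ?_ e0
    calc (m.choose k : ℝ) * 2 ^ k * (Real.exp 1 ^ k * (k.factorial : ℝ))
        = (m.choose k * k.factorial) * (Real.exp 1 ^ k * 2 ^ k) := by ring
      _ ≤ m ^ k * (Real.exp 1 ^ k * 2 ^ k) := by gcongr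
      _ = ((m : ℝ) * Real.exp 1 * 2) ^ k := by rw [mul_pow, mul_pow]; ring
      _ ≤ _ := hpow
      _ = N ^ (ℓ * k) * k ^ k := by rw [mul_pow, ← pow_mul]; ring
      _ ≤ _ := by gcongr
  have hA : (A : ℝ) / N ^ m ≤ 1 / 2 ^ k := by
    rw [div_le_div_iff₀ (by positivity) (by positivity), one_mul]
    have e0 : 0 < N ^ (ℓ * k) := by positivity
    refine le_of_mul_le_mul_right ?_ e0
    calc (A : ℝ) * 2 ^ k * N ^ (ℓ * k) = (A * N ^ (ℓ * k)) * 2 ^ k := by ring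
      _ ≤ (m.choose k * N ^ m) * 2 ^ k := by gcongr
      _ = N ^ m * (m.choose k * 2 ^ k) := by ring
      _ ≤ _ := by gcongr
  refine hA.trans ?_
  rw [← Real.rpow_natCast 2 k]
  apply one_div_le_one_div_of_le (by positivity)
  apply Real.rpow_le_rpow_of_exponent_le (by norm_num)
  have : N ^ (ε / 3) ≤ x := Real.rpow_le_rpow_of_exponent_le hN1 (by linarith)
  linarith
end

section
/- Fix c ≥ 1, ε with 0 < ε < 1/c, and ℓ ≥ 1, and let n be a function from m to the positive integers with n(m)^{ℓ + 1/c − ε} = Ω(m). There is an m_0 such that for all m ≥ m_0 the following holds: if S is chosen uniformly at random from {1,…,n}^m, then Pr[ c · H_ℓ(S) ≥ (1 − 2ε/3) log n ] ≤ n^ℓ / 2^{n^{ε/3} − ℓ}. -/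
open scoped BigOperators

/-- occurrence positions -/
def occPos {n m : ℕ} (ℓ : ℕ) (α : Fin ℓ → Fin n) (S : Fin m → Fin n) : Finset ℕ :=
  (Finset.range m).filter fun i => ((List.ofFn S).drop i).take ℓ = List.ofFn α

theorem filterMap_len {A : Type*} (l : List ℕ) (p : ℕ → Prop) [DecidablePred p]
    (g : ℕ → Option A) :
    (l.filterMap fun i => if p i then g i else none).length ≤ (l.filter (fun i => p i)).length := by
  induction l with
  | nil => simp
  | cons a l ih =>
    by_cases h : p a
    · cases hg : g a with
      | none => simp [h, hg]; omega
      | some b => simp [h, hg]; omega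
    · simp [h]; omega

theorem follow_len {n m ℓ : ℕ} (α : Fin ℓ → Fin n) (S : Fin m → Fin n) :
    (follow (List.ofFn α) (List.ofFn S)).length ≤ (occPos ℓ α S).card := by
  unfold follow
  refine (filterMap_len _ _ _).trans (le_of_eq ?_)
  unfold occPos
  rw [← List.toFinset_card_of_nodup (List.nodup_range.filter _)]
  congr 1
  ext i
  simp

theorem occPos_spec {n m ℓ : ℕ} (α : Fin ℓ → Fin n) (S : Fin m → Fin n) (i : ℕ)
    (hi : i ∈ occPos ℓ α S) (j : Fin ℓ) : ∃ h : i + j < m, S ⟨i + j, h⟩ = α j := by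
  unfold occPos at hi
  rw [Finset.mem_filter] at hi
  have h2 := congrArg (fun l : List (Fin n) => l[(j : ℕ)]?) hi.2
  simp only [List.getElem?_take, List.getElem?_drop, List.getElem?_ofFn, j.2, if_true,
    dif_pos] at h2
  by_cases h : i + j < m
  · refine ⟨h, ?_⟩
    simpa [h] using h2
  · simp [h] at h2

theorem sum_occ {n m ℓ : ℕ} (S : Fin m → Fin n) :
    ∑ α : Fin ℓ → Fin n, (occPos ℓ α S).card ≤ m := by
  rw [← Finset.card_biUnion]
  · refine (Finset.card_le_card (t := Finset.range m) ?_).trans (by simp)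
    intro i hi
    simp only [Finset.mem_biUnion, occPos, Finset.mem_filter] at hi
    obtain ⟨_, _, h, _⟩ := hi
    exact h
  · intro a _ b _ hab
    change Disjoint (occPos ℓ a S) (occPos ℓ b S)
    rw [Finset.disjoint_left]
    intro i h1 h2
    unfold occPos at h1 h2
    rw [Finset.mem_filter] at h1 h2
    exact hab (List.ofFn_injective (h1.2.symm.trans h2.2))

theorem H0_le {n : ℕ} (L : List (Fin n)) (T : ℝ) (hT : 1 ≤ T) (hL : (L.length : ℝ) ≤ T) :
    (L.length : ℝ) * H0 L ≤ L.length * Real.logb 2 T := by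
  refine mul_le_mul_of_nonneg_left ?_ (by positivity)
  have hlT : 0 ≤ Real.logb 2 T := Real.logb_nonneg (by norm_num) hT
  rcases Nat.eq_zero_or_pos L.length with h0 | h0
  · rw [List.length_eq_zero_iff] at h0
    subst h0
    simpa [H0] using hlT
  · have hp : (0 : ℝ) < L.length := by exact_mod_cast h0
    unfold H0
    calc _ ≤ ∑ a ∈ L.toFinset, ((L.count a : ℝ) / L.length) * Real.logb 2 T := by
          refine Finset.sum_le_sum fun a ha => ?_
          refine mul_le_mul_of_nonneg_left ?_ (by positivity)
          have hc : 0 < L.count a := List.count_pos_iff.2 (by simpa using ha)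
          have hc' : (1 : ℝ) ≤ L.count a := by exact_mod_cast hc
          refine Real.logb_le_logb_of_le (by norm_num) (by positivity) ?_
          exact (div_le_self hp.le hc').trans hL
      _ = Real.logb 2 T := by
          rw [← Finset.sum_mul, ← Finset.sum_div, ← Nat.cast_sum, List.sum_toFinset_count_eq_length,
            div_self hp.ne', one_mul]

theorem empEnt_le {n m ℓ : ℕ} (hℓ : 1 ≤ ℓ) (S : Fin m → Fin n) (T : ℝ) (hT : 1 ≤ T)
    (h : ∀ α : Fin ℓ → Fin n, ((occPos ℓ α S).card : ℝ) ≤ T) :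
    empEnt n ℓ (List.ofFn S) ≤ Real.logb 2 T := by
  have hlT : 0 ≤ Real.logb 2 T := Real.logb_nonneg (by norm_num) hT
  unfold empEnt
  rw [if_neg (by omega), List.length_ofFn]
  rcases Nat.eq_zero_or_pos m with h0 | h0
  · subst h0; simpa using hlT
  have hm : (0 : ℝ) < m := by exact_mod_cast h0
  rw [inv_mul_le_iff₀ hm]
  calc _ ≤ ∑ α : Fin ℓ → Fin n,
        ((follow (List.ofFn α) (List.ofFn S)).length : ℝ) * Real.logb 2 T :=
        Finset.sum_le_sum fun α _ => H0_le _ T hT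
          (le_trans (by exact_mod_cast follow_len α S) (h α))
    _ ≤ ∑ α : Fin ℓ → Fin n, ((occPos ℓ α S).card : ℝ) * Real.logb 2 T :=
        Finset.sum_le_sum fun α _ => mul_le_mul_of_nonneg_right
          (by exact_mod_cast follow_len α S) hlT
    _ ≤ m * Real.logb 2 T := by
        rw [← Finset.sum_mul]
        refine mul_le_mul_of_nonneg_right ?_ hlT
        exact_mod_cast sum_occ (ℓ := ℓ) S

/-- strings with prescribed occurrences at a set of pairwise congruent positions -/
theorem card_fixed {n m ℓ : ℕ} (hn : 0 < n) (α : Fin ℓ → Fin n) (U : Finset ℕ)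
    (hU : ∀ i ∈ U, ∀ i' ∈ U, i % ℓ = i' % ℓ) :
    (Finset.univ.filter fun S : Fin m → Fin n => U ⊆ occPos ℓ α S).card * n ^ (U.card * ℓ)
      ≤ n ^ m := by
  classical
  rcases Finset.eq_empty_or_nonempty
    (Finset.univ.filter fun S : Fin m → Fin n => U ⊆ occPos ℓ α S) with he | ⟨S0, hS0⟩
  · rw [he]; simp
  rw [Finset.mem_filter] at hS0
  have hb : ∀ p : U × Fin ℓ, (p.1 : ℕ) + p.2 < m := fun p =>
    (occPos_spec α S0 p.1 (hS0.2 p.1.2) p.2).1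
  let e : U × Fin ℓ → Fin m := fun p => ⟨p.1 + p.2, hb p⟩
  have he : Function.Injective e := by
    rintro ⟨⟨i, hi⟩, j⟩ ⟨⟨i', hi'⟩, j'⟩ h
    simp only [e, Fin.mk.injEq] at h
    have h1 := hU i hi i' hi'
    have h2 : (j : ℕ) ≡ j' [MOD ℓ] := by
      have h3 : i ≡ i' [MOD ℓ] := h1
      exact Nat.ModEq.add_left_cancel h3 (by rw [h])
    have h3 : (j : ℕ) = j' := Nat.ModEq.eq_of_lt_of_lt h2 j.2 j'.2
    have h4 : i = i' := by omega
    subst h4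
    have h5 : j = j' := Fin.ext h3
    subst h5
    rfl
  let W : Finset (Fin m) := Finset.univ.image e
  have hW : W.card = U.card * ℓ := by
    rw [Finset.card_image_of_injective _ he]
    simp
  let t : Fin m → Finset (Fin n) := fun x => if x ∈ W then {S0 x} else Finset.univ
  have hsub : (Finset.univ.filter fun S : Fin m → Fin n => U ⊆ occPos ℓ α S)
      ⊆ Fintype.piFinset t := by
    intro S hS
    rw [Finset.mem_filter] at hS
    rw [Fintype.mem_piFinset]
    intro x
    by_cases hx : x ∈ W
    · simp only [t, hx, if_true, Finset.mem_singleton]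
      obtain ⟨⟨i, j⟩, _, rfl⟩ := Finset.mem_image.1 hx
      exact ((occPos_spec α S i (hS.2 i.2) j).2).trans (occPos_spec α S0 i (hS0.2 i.2) j).2.symm
    · simp [t, hx]
  have hcard : (Fintype.piFinset t).card = n ^ (m - W.card) := by
    rw [Fintype.card_piFinset]
    have : ∀ x, (t x).card = if x ∈ W then 1 else n := by
      intro x
      by_cases hx : x ∈ W <;> simp [t, hx]
    simp only [this]
    rw [Finset.prod_ite]
    simp [Finset.filter_not, Finset.card_sdiff]
  have hWm : W.card ≤ m := by simpa using Finset.card_le_univ W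
  calc _ ≤ n ^ (m - W.card) * n ^ (U.card * ℓ) :=
        Nat.mul_le_mul_right _ ((Finset.card_le_card hsub).trans hcard.le)
    _ = n ^ m := by rw [← hW, ← pow_add]; congr 1; omega

theorem card_many {n m ℓ k : ℕ} (hn : 0 < n) (hℓ : 1 ≤ ℓ) (α : Fin ℓ → Fin n) (T : ℝ)
    (hk : (ℓ : ℝ) * k < T + ℓ) (hk1 : 1 ≤ k) :
    (Finset.univ.filter fun S : Fin m → Fin n => T < ((occPos ℓ α S).card : ℝ)).card
      * n ^ (k * ℓ) ≤ m.choose k * n ^ m := by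
  let F := ((Finset.range m).powersetCard k).filter
    fun U => ∀ i ∈ U, ∀ i' ∈ U, i % ℓ = i' % ℓ
  have hsub : (Finset.univ.filter fun S : Fin m → Fin n => T < ((occPos ℓ α S).card : ℝ)) ⊆
      F.biUnion fun U => Finset.univ.filter fun S : Fin m → Fin n => U ⊆ occPos ℓ α S := by
    intro S hS
    rw [Finset.mem_filter] at hS
    have h1 : (Finset.range ℓ).card * (k - 1) < (occPos ℓ α S).card := by
      rw [Finset.card_range]
      have : ((ℓ * (k - 1) : ℕ) : ℝ) < (occPos ℓ α S).card := by
        push_cast [Nat.cast_sub hk1]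
        linarith [hS.2]
      exact_mod_cast this
    obtain ⟨r, _, hr⟩ := Finset.exists_lt_card_fiber_of_mul_lt_card_of_maps_to
      (f := fun i => i % ℓ) (s := occPos ℓ α S) (t := Finset.range ℓ)
      (fun i _ => Finset.mem_range.2 (Nat.mod_lt _ hℓ)) h1
    obtain ⟨U, hUs, hUc⟩ := Finset.exists_subset_card_eq
      (show k ≤ ((occPos ℓ α S).filter fun i => i % ℓ = r).card by omega)
    rw [Finset.mem_biUnion]
    have hUo : U ⊆ occPos ℓ α S := hUs.trans (Finset.filter_subset _ _)
    refine ⟨U, ?_, ?_⟩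
    · simp only [F, Finset.mem_filter, Finset.mem_powersetCard]
      refine ⟨⟨hUo.trans (Finset.filter_subset _ _), hUc⟩, ?_⟩
      intro i hi i' hi'
      exact ((Finset.mem_filter.1 (hUs hi)).2).trans ((Finset.mem_filter.1 (hUs hi')).2).symm
    · simpa using hUo
  have hF : F.card ≤ m.choose k := by
    have hle : F.card ≤ ((Finset.range m).powersetCard k).card :=
      Finset.card_le_card (Finset.filter_subset _ _)
    simpa using hle
  calc _ ≤ (∑ U ∈ F, (Finset.univ.filter fun S : Fin m → Fin n => U ⊆ occPos ℓ α S).card)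
          * n ^ (k * ℓ) :=
        Nat.mul_le_mul_right _ ((Finset.card_le_card hsub).trans Finset.card_biUnion_le)
    _ = ∑ U ∈ F, (Finset.univ.filter fun S : Fin m → Fin n => U ⊆ occPos ℓ α S).card
          * n ^ (k * ℓ) := Finset.sum_mul _ _ _
    _ ≤ ∑ U ∈ F, n ^ m := by
        refine Finset.sum_le_sum fun U hU => ?_
        simp only [F, Finset.mem_filter, Finset.mem_powersetCard] at hU
        have := card_fixed (m := m) hn α U hU.2
        rwa [hU.1.2] at this
    _ ≤ m.choose k * n ^ m := by
        rw [Finset.sum_const, smul_eq_mul]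
        exact Nat.mul_le_mul_right _ hF

theorem choose_bound (m k N : ℕ) (hN : 0 < N) (hk : 0 < k)
    (h : 2 * Real.exp 1 * m ≤ k * N) :
    (m.choose k : ℝ) / (N : ℝ) ^ k ≤ (1 / 2) ^ k := by
  have hN' : (0 : ℝ) < N := by exact_mod_cast hN
  have hk' : (0 : ℝ) < k := by exact_mod_cast hk
  have h1 : (m.choose k : ℝ) ≤ (m : ℝ) ^ k / k.factorial := Nat.choose_le_pow_div k m
  have h2 : (k : ℝ) ^ k / k.factorial ≤ Real.exp k := Real.pow_div_factorial_le_exp _ hk'.le k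
  have h3 : Real.exp k = Real.exp 1 ^ k := by rw [← Real.exp_nat_mul, mul_one]
  have h4 : (1 : ℝ) / k.factorial ≤ (Real.exp 1 / k) ^ k := by
    rw [div_pow, ← h3, le_div_iff₀ (by positivity)]
    calc _ = (k : ℝ) ^ k / k.factorial := by ring
      _ ≤ _ := h2
  calc (m.choose k : ℝ) / (N : ℝ) ^ k ≤ ((m : ℝ) ^ k * (Real.exp 1 / k) ^ k) / N ^ k := by
        gcongr
        refine h1.trans ?_
        rw [div_eq_mul_one_div]
        gcongr
    _ = (m * Real.exp 1 / (k * N)) ^ k := by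
        rw [← mul_pow, ← div_pow]; congr 1; field_simp
    _ ≤ (1 / 2) ^ k := by
        refine pow_le_pow_left₀ (by positivity) ?_ k
        rw [div_le_iff₀ (by positivity)]
        linarith

theorem card_many_real {n m ℓ : ℕ} (hn : 0 < n) (hℓ : 1 ≤ ℓ) (α : Fin ℓ → Fin n) (T : ℝ)
    (hT : 0 < T) (h : 2 * Real.exp 1 * ℓ * m ≤ T * (n : ℝ) ^ ℓ) :
    ((Finset.univ.filter fun S : Fin m → Fin n => T < ((occPos ℓ α S).card : ℝ)).card : ℝ)
      ≤ (n : ℝ) ^ m / (2 : ℝ) ^ (T / ℓ) := by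
  have hn' : (0 : ℝ) < n := by exact_mod_cast hn
  have hℓ' : (0 : ℝ) < ℓ := by exact_mod_cast hℓ
  set k := ⌈T / ℓ⌉₊ with hkdef
  have hTl : 0 < T / ℓ := by positivity
  have hk1 : 0 < k := Nat.ceil_pos.2 hTl
  have hk2 : T / ℓ ≤ k := Nat.le_ceil _
  have hk3 : (k : ℝ) < T / ℓ + 1 := Nat.ceil_lt_add_one hTl.le
  have hk4 : (ℓ : ℝ) * k < T + ℓ := by
    have := mul_lt_mul_of_pos_left hk3 hℓ'
    rwa [mul_add, mul_div_cancel₀ _ hℓ'.ne', mul_one] at this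
  have h1 := card_many (m := m) hn hℓ α T hk4 hk1
  have h1' : ((Finset.univ.filter fun S : Fin m → Fin n =>
      T < ((occPos ℓ α S).card : ℝ)).card : ℝ) * ((n ^ ℓ : ℕ) : ℝ) ^ k
      ≤ m.choose k * (n : ℝ) ^ m := by
    have : (n ^ ℓ) ^ k = n ^ (k * ℓ) := by rw [← pow_mul, mul_comm]
    rw [← this] at h1
    exact_mod_cast h1
  have h2 : (m.choose k : ℝ) / ((n ^ ℓ : ℕ) : ℝ) ^ k ≤ (1 / 2) ^ k := by
    refine choose_bound m k (n ^ ℓ) (by positivity) hk1 ?_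
    push_cast
    have h5 : T ≤ k * ℓ := (div_le_iff₀ hℓ').1 hk2
    have h6 : T * (n : ℝ) ^ ℓ ≤ k * ℓ * (n : ℝ) ^ ℓ := by gcongr
    refine le_of_mul_le_mul_left ?_ hℓ'
    linarith
  have h3 : ((1 : ℝ) / 2) ^ k ≤ 1 / (2 : ℝ) ^ (T / ℓ) := by
    rw [one_div_pow]
    refine one_div_le_one_div_of_le (by positivity) ?_
    rw [← Real.rpow_natCast]
    exact Real.rpow_le_rpow_of_exponent_le (by norm_num) hk2
  have hNp : (0 : ℝ) < ((n ^ ℓ : ℕ) : ℝ) ^ k := by positivity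
  calc _ ≤ m.choose k * (n : ℝ) ^ m / ((n ^ ℓ : ℕ) : ℝ) ^ k := (le_div_iff₀ hNp).2 h1'
    _ = (m.choose k : ℝ) / ((n ^ ℓ : ℕ) : ℝ) ^ k * (n : ℝ) ^ m := by ring
    _ ≤ (1 / (2 : ℝ) ^ (T / ℓ)) * (n : ℝ) ^ m := by
        exact mul_le_mul_of_nonneg_right (h2.trans h3) (by positivity)
    _ = _ := by ring

/-- fix `c ≥ 1`, `0 < ε < 1/c`, `ℓ ≥ 1`, and `n(m)` with
`n(m)^{ℓ+1/c−ε} = Ω(m)`. For all sufficiently large `m`, for a uniformly random string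
`S ∈ {1,…,n}^m`, `Pr[c H_ℓ(S) ≥ (1 − 2ε/3) log n] ≤ n^ℓ / 2^{n^{ε/3}−ℓ}`. -/
theorem statement10 (c ε : ℝ) (hc : 1 ≤ c) (hε : 0 < ε) (hεc : ε < 1 / c)
    (ℓ : ℕ) (hℓ : 1 ≤ ℓ) (n : ℕ → ℕ) (hn : ∀ m, 0 < n m)
    (hΩ : ∃ C : ℝ, 0 < C ∧ ∃ m₁ : ℕ, ∀ m ≥ m₁,
      C * m ≤ (n m : ℝ) ^ ((ℓ : ℝ) + 1 / c - ε)) :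
    ∃ m₀ : ℕ, ∀ m ≥ m₀,
      (Nat.card {S : Fin m → Fin (n m) //
          (1 - 2 * ε / 3) * Real.logb 2 (n m) ≤ c * empEnt (n m) ℓ (List.ofFn S)} : ℝ) /
          (n m : ℝ) ^ m ≤
        (n m : ℝ) ^ ℓ / (2 : ℝ) ^ ((n m : ℝ) ^ (ε / 3) - ℓ) := by
  classical
  obtain ⟨C, hC, m₁, hm₁⟩ := hΩ
  have hc0 : 0 < c := by linarith
  have hci : 1 / c ≤ 1 := by rw [div_le_one hc0]; exact hc
  have hc1 : 0 < 1 / c := by positivity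
  have hℓ' : (1 : ℝ) ≤ ℓ := by exact_mod_cast hℓ
  set a : ℝ := (ℓ : ℝ) + 1 / c - ε with ha
  set b : ℝ := 1 / c * (1 - 2 * ε / 3) with hb
  have ha0 : 0 < a := by rw [ha]; linarith
  have hb1 : 0 < b - ε / 3 := by
    rw [hb]; nlinarith
  have hb2 : 0 < b - (1 / c - ε) := by
    rw [hb]; nlinarith
  have hb0 : 0 < b := by linarith
  -- n tends to infinity
  have hnt : Filter.Tendsto (fun m => (n m : ℝ)) Filter.atTop Filter.atTop := by
    have h1 : Filter.Tendsto (fun m : ℕ => (C * (m : ℝ)) ^ (1 / a)) Filter.atTop Filter.atTop :=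
      (tendsto_rpow_atTop (by positivity)).comp
        (tendsto_natCast_atTop_atTop.const_mul_atTop hC)
    refine Filter.tendsto_atTop_mono' _ ?_ h1
    filter_upwards [Filter.eventually_ge_atTop m₁] with m hm
    have := Real.rpow_le_rpow (by positivity) (hm₁ m hm) (z := 1 / a) (by positivity)
    rwa [← Real.rpow_mul (by positivity), mul_one_div_cancel ha0.ne', Real.rpow_one] at this
  have e1 := ((tendsto_rpow_atTop hb1).comp hnt).eventually_ge_atTop (2 * (ℓ : ℝ))
  have e2 := ((tendsto_rpow_atTop hb2).comp hnt).eventually_ge_atTop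
    (4 * Real.exp 1 * ℓ / C)
  have e3 := ((tendsto_rpow_atTop hb0).comp hnt).eventually_ge_atTop 2
  have hev := (e1.and (e2.and (e3.and (Filter.eventually_ge_atTop m₁))))
  obtain ⟨m₀, hm₀⟩ := Filter.eventually_atTop.1 hev
  refine ⟨m₀, fun m hm => ?_⟩
  obtain ⟨g1, g2, g3, g4⟩ := hm₀ m hm
  simp only [Function.comp] at g1 g2 g3
  have hΩm := hm₁ m g4
  have hnm := hn m
  generalize n m = N at *
  have hN : (0 : ℝ) < N := by exact_mod_cast hnm
  set T : ℝ := (N : ℝ) ^ b / 2 with hTdef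
  have hNb : (0 : ℝ) < (N : ℝ) ^ b := by positivity
  have hT1 : 1 ≤ T := by rw [hTdef]; linarith
  have hTl : (N : ℝ) ^ (ε / 3) ≤ T / ℓ := by
    rw [le_div_iff₀ (by linarith), hTdef]
    have : (N : ℝ) ^ b = (N : ℝ) ^ (b - ε / 3) * (N : ℝ) ^ (ε / 3) := by
      rw [← Real.rpow_add hN]; congr 1; ring
    rw [this]
    have h0 : (0 : ℝ) < (N : ℝ) ^ (ε / 3) := by positivity
    nlinarith
  have hTm : 2 * Real.exp 1 * ℓ * m ≤ T * (N : ℝ) ^ ℓ := by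
    have h1 : (N : ℝ) ^ b * (N : ℝ) ^ ℓ = (N : ℝ) ^ (b - (1 / c - ε)) * (N : ℝ) ^ a := by
      rw [← Real.rpow_natCast, ← Real.rpow_add hN, ← Real.rpow_add hN]; congr 1; rw [ha]; ring
    have h2 : 4 * Real.exp 1 * ℓ / C * (C * m) ≤ (N : ℝ) ^ (b - (1 / c - ε)) * (N : ℝ) ^ a := by
      gcongr
    have h3 : 4 * Real.exp 1 * ℓ / C * (C * m) = 4 * Real.exp 1 * ℓ * m := by
      field_simp
    rw [hTdef]
    linarith
  rw [div_le_iff₀ (by positivity)]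
  have hcardle : Nat.card {S : Fin m → Fin N //
      (1 - 2 * ε / 3) * Real.logb 2 N ≤ c * empEnt N ℓ (List.ofFn S)} ≤
      ∑ α : Fin ℓ → Fin N, (Finset.univ.filter fun S : Fin m → Fin N =>
        T < ((occPos ℓ α S).card : ℝ)).card := by
    rw [Nat.card_eq_fintype_card, Fintype.card_subtype]
    refine (Finset.card_le_card (t := Finset.univ.biUnion fun α : Fin ℓ → Fin N =>
      Finset.univ.filter fun S : Fin m → Fin N => T < ((occPos ℓ α S).card : ℝ)) ?_).trans
      Finset.card_biUnion_le
    intro S hS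
    rw [Finset.mem_filter] at hS
    by_contra hcon
    have hall : ∀ α : Fin ℓ → Fin N, ((occPos ℓ α S).card : ℝ) ≤ T := by
      intro α
      by_contra hlt
      exact hcon (by simpa using ⟨α, not_le.1 hlt⟩)
    have h1 := empEnt_le hℓ S T hT1 hall
    have h2 : Real.logb 2 T < Real.logb 2 ((N : ℝ) ^ b) :=
      Real.logb_lt_logb (by norm_num) (by linarith) (by rw [hTdef]; linarith)
    rw [Real.logb_rpow_eq_mul_logb_of_pos hN] at h2
    have h3 : c * empEnt N ℓ (List.ofFn S) < c * (b * Real.logb 2 N) :=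
      mul_lt_mul_of_pos_left (h1.trans_lt h2) hc0
    have h4 : c * (b * Real.logb 2 N) = (1 - 2 * ε / 3) * Real.logb 2 N := by
      rw [hb]; field_simp
    linarith [hS.2]
  calc _ ≤ ((∑ α : Fin ℓ → Fin N, (Finset.univ.filter fun S : Fin m → Fin N =>
        T < ((occPos ℓ α S).card : ℝ)).card : ℕ) : ℝ) := by exact_mod_cast hcardle
    _ ≤ ∑ α : Fin ℓ → Fin N, (N : ℝ) ^ m / (2 : ℝ) ^ (T / ℓ) := by
        rw [Nat.cast_sum]
        exact Finset.sum_le_sum fun α _ => card_many_real hnm hℓ α T (by linarith) hTm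
    _ = (N : ℝ) ^ ℓ / (2 : ℝ) ^ (T / ℓ) * (N : ℝ) ^ m := by
        simp; ring
    _ ≤ _ := by
        gcongr
        · norm_num
        · linarith
end

section
/- Fix c ≥ 1 and ε with 0 < ε < 1/c. There do not exist a constant C > 0 and a function g(n) = o(log n) such that for every n there is a finite set 𝒬_n of probability distributions over {1,…,n} with |𝒬_n| ≤ 2^{C · n^{1/c − ε}} such that every probability distribution P over {1,…,n} has some Q ∈ 𝒬_n with D(P ‖ Q) ≤ (c − 1) H(P) + g(n). In other words, in the worst case, storing a distribution Q with D(P ‖ Q) ≤ (c − 1) H(P) + o(log n) takes ω(n^{1/c − ε}) bits. -/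
open scoped BigOperators

/-- transfer a sum against the uniform distribution on the image of an embedding -/
lemma sum_unif {n k : ℕ} (f : Fin k ↪ Fin n) (P : Fin n → ℝ)
    (hP : P = fun a => if a ∈ Finset.univ.map f then (1 / k : ℝ) else 0)
    (G : ℝ → Fin n → ℝ) :
    ∑ a, P a * G (P a) a = ∑ i, (1 / k : ℝ) * G (1 / k) (f i) := by
  have h1 : ∑ a, P a * G (P a) a = ∑ a ∈ Finset.univ.map f, P a * G (P a) a := by
    symm
    apply Finset.sum_subset (Finset.subset_univ _)
    intro a _ ha
    rw [hP]
    simp only [if_neg ha, zero_mul]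
  rw [h1, Finset.sum_map]
  apply Finset.sum_congr rfl
  intro i _
  have : P (f i) = 1 / k := by
    rw [hP]
    simp
  rw [this]

lemma counting {n k : ℕ} (hk : 0 < k) (c g : ℝ) (𝒬 : Finset (Fin n → ℝ))
    (hQ : ∀ Q ∈ 𝒬, (∀ a, 0 ≤ Q a) ∧ ∑ a, Q a = 1)
    (h : ∀ P : Fin n → ℝ, (∀ a, 0 ≤ P a) → ∑ a, P a = 1 →
            ∃ Q ∈ 𝒬, (∀ a, 0 < P a → 0 < Q a) ∧
              relEnt P Q ≤ (c - 1) * entropy P + g) :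
    (n.descFactorial k : ℝ) * 2 ^ (-(k * (c * Real.logb 2 k + g))) ≤ (𝒬.card : ℝ) := by
  have hk' : (0 : ℝ) < k := by exact_mod_cast hk
  have key : ∀ f : Fin k ↪ Fin n,
      (2 : ℝ) ^ (-(k * (c * Real.logb 2 k + g))) ≤ ∑ Q ∈ 𝒬, ∏ i, Q (f i) := by
    intro f
    obtain ⟨P, hP⟩ : ∃ P : Fin n → ℝ,
      P = fun a => if a ∈ Finset.univ.map f then (1 / k : ℝ) else 0 := ⟨_, rfl⟩
    have hP0 : ∀ a, 0 ≤ P a := by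
      intro a
      rw [hP]
      dsimp only
      split_ifs <;> positivity
    have hP1 : ∑ a, P a = 1 := by
      have := sum_unif f P hP (fun _ _ => 1)
      simp only [mul_one] at this
      rw [this]
      simp
      field_simp
    obtain ⟨Q, hQm, hac, hD⟩ := h P hP0 hP1
    have hpos : ∀ i, 0 < Q (f i) := by
      intro i
      apply hac
      rw [hP]
      simp [hk]
    have hH : entropy P = Real.logb 2 k := by
      have := sum_unif f P hP (fun x _ => Real.logb 2 (1 / x))
      unfold entropy
      rw [this]
      simp
      field_simp
    have hR : relEnt P Q = - Real.logb 2 k - (1 / k) * ∑ i, Real.logb 2 (Q (f i)) := by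
      have := sum_unif f P hP (fun x a => Real.logb 2 (x / Q a))
      unfold relEnt
      rw [this]
      have h2 : ∀ i, Real.logb 2 ((1 / k : ℝ) / Q (f i))
          = - Real.logb 2 k - Real.logb 2 (Q (f i)) := by
        intro i
        rw [Real.logb_div (by positivity) (hpos i).ne', one_div, Real.logb_inv]
      simp only [h2]
      rw [← Finset.mul_sum, Finset.sum_sub_distrib]
      simp
      field_simp
    rw [hH, hR] at hD
    have hprod : (2 : ℝ) ^ (-(k * (c * Real.logb 2 k + g))) ≤ ∏ i, Q (f i) := by
      have hpp : 0 < ∏ i, Q (f i) := Finset.prod_pos fun i _ => hpos i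
      rw [← Real.le_logb_iff_rpow_le (by norm_num) hpp,
        Real.logb_prod _ _ (fun i _ => (hpos i).ne')]
      have h3 : -(c * Real.logb 2 k + g) ≤ (1 / k) * ∑ i, Real.logb 2 (Q (f i)) := by
        linarith
      have h4 := mul_le_mul_of_nonneg_left h3 hk'.le
      rw [← mul_assoc, mul_one_div_cancel hk'.ne', one_mul] at h4
      linarith
    refine hprod.trans ?_
    exact Finset.single_le_sum (f := fun Q : Fin n → ℝ => ∏ i, Q (f i))
      (fun Q hq => Finset.prod_nonneg fun i _ => (hQ Q hq).1 _) hQm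
  have hsum : ∑ _f : Fin k ↪ Fin n, (2 : ℝ) ^ (-(k * (c * Real.logb 2 k + g)))
      ≤ ∑ f : Fin k ↪ Fin n, ∑ Q ∈ 𝒬, ∏ i, Q (f i) := Finset.sum_le_sum fun f _ => key f
  rw [Finset.sum_comm] at hsum
  have hq1 : ∀ Q ∈ 𝒬, ∑ f : Fin k ↪ Fin n, ∏ i, Q (f i) ≤ 1 := by
    intro Q hq
    have h5 : ∑ f : Fin k → Fin n, ∏ i, Q (f i) = 1 := by
      have := Finset.prod_univ_sum (fun _ : Fin k => (Finset.univ : Finset (Fin n)))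
        (fun _ a => Q a)
      simp only [(hQ Q hq).2, Finset.prod_const_one, Fintype.piFinset_univ] at this
      exact this.symm
    rw [← h5]
    let e : (Fin k ↪ Fin n) ↪ (Fin k → Fin n) := ⟨fun f => f, DFunLike.coe_injective⟩
    have h6 : ∑ f : Fin k ↪ Fin n, ∏ i, Q (f i)
        = ∑ f ∈ Finset.univ.map e, ∏ i, Q (f i) := by
      rw [Finset.sum_map]
      rfl
    rw [h6]
    exact Finset.sum_le_sum_of_subset_of_nonneg (Finset.subset_univ _)
      fun f _ _ => Finset.prod_nonneg fun i _ => (hQ Q hq).1 _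
  have h7 := hsum.trans (Finset.sum_le_sum hq1)
  simpa [Fintype.card_embedding_eq] using h7

/-- fix `c ≥ 1` and `0 < ε < 1/c`. There are no constant `C > 0` and
function `g(n) = o(log n)` such that for every `n` some set of at most `2^{C n^{1/c−ε}}`
probability distributions over `{1,…,n}` contains, for each distribution `P`, some `Q`
with `D(P‖Q) ≤ (c−1) H(P) + g(n)` (finiteness of `D(P‖Q)` being expressed by the
absolute-continuity condition `P a > 0 → Q a > 0`). -/
theorem statement12 (c ε : ℝ) (hc : 1 ≤ c) (hε : 0 < ε) (hεc : ε < 1 / c) :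
    ¬ ∃ (C : ℝ) (g : ℕ → ℝ), 0 < C ∧
      Filter.Tendsto (fun n : ℕ => g n / Real.logb 2 n) Filter.atTop (nhds 0) ∧
      ∀ n : ℕ, 0 < n →
        ∃ 𝒬 : Finset (Fin n → ℝ),
          (∀ Q ∈ 𝒬, (∀ a, 0 ≤ Q a) ∧ ∑ a, Q a = 1) ∧
          (𝒬.card : ℝ) ≤ 2 ^ (C * (n : ℝ) ^ (1 / c - ε)) ∧
          ∀ P : Fin n → ℝ, (∀ a, 0 ≤ P a) → ∑ a, P a = 1 →
            ∃ Q ∈ 𝒬, (∀ a, 0 < P a → 0 < Q a) ∧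
              relEnt P Q ≤ (c - 1) * entropy P + g n := by
  rintro ⟨C, g, hC, hg, H⟩
  have hc0 : 0 < c := by linarith
  set δ := 1 / c - ε with hδ
  have hδ0 : 0 < δ := by linarith
  have hcδ : c * δ = 1 - c * ε := by
    rw [hδ]
    field_simp
  have hδ1 : δ < 1 := by
    have : 1 / c ≤ 1 := by
      rw [div_le_one hc0]
      exact hc
    linarith
  have hcε : 0 < c * ε := by positivity
  have e1 : ∀ᶠ n : ℕ in Filter.atTop, g n / Real.logb 2 n < c * ε / 2 :=
    hg.eventually_lt_const (by positivity)
  have e2 : ∀ᶠ n : ℕ in Filter.atTop, 4 ≤ (n : ℝ) ^ (1 - δ) :=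
    ((tendsto_rpow_atTop (by linarith : 0 < 1 - δ)).comp
      tendsto_natCast_atTop_atTop).eventually_ge_atTop 4
  have e3 : ∀ᶠ n : ℕ in Filter.atTop, 2 * (1 + C + c) / (c * ε) + 1 ≤ Real.logb 2 n :=
    ((Real.tendsto_logb_atTop (by norm_num)).comp
      tendsto_natCast_atTop_atTop).eventually_ge_atTop _
  obtain ⟨n, h1, h2, h3, hn⟩ :=
    (e1.and (e2.and (e3.and (Filter.eventually_ge_atTop 1)))).exists
  have hn0 : (0 : ℝ) < n := by exact_mod_cast hn
  have hn1 : (1 : ℝ) ≤ n := by exact_mod_cast hn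
  obtain ⟨𝒬, hQ, hcard, hP⟩ := H n hn
  set x := (n : ℝ) ^ δ with hx
  have hx1 : 1 ≤ x := Real.one_le_rpow hn1 hδ0.le
  have hxn : 4 * x ≤ n := by
    have : (n : ℝ) = (n : ℝ) ^ (1 - δ) * x := by
      rw [hx, ← Real.rpow_add hn0]
      simp
    rw [this]
    gcongr
  set k := ⌈x⌉₊ with hkdef
  have hkx : x ≤ k := Nat.le_ceil x
  have hkx2 : (k : ℝ) ≤ 2 * x := by
    have := Nat.ceil_lt_add_one (by linarith : 0 ≤ x)
    rw [← hkdef] at this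
    linarith
  have hk0 : (0 : ℝ) < k := by linarith
  have hkpos : 0 < k := by exact_mod_cast hk0
  have hkn : k ≤ n := by
    have : (k : ℝ) ≤ n := by linarith
    exact_mod_cast this
  have hcount := (counting hkpos c (g n) 𝒬 hQ hP).trans hcard
  have hdesc : ((n : ℝ) / 2) ^ k ≤ (n.descFactorial k : ℝ) := by
    have h4 : (((n + 1 - k) ^ k : ℕ) : ℝ) ≤ (n.descFactorial k : ℝ) := by
      exact_mod_cast Nat.pow_sub_le_descFactorial n k
    refine le_trans ?_ h4
    rw [Nat.cast_pow, Nat.cast_sub (by omega)]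
    push_cast
    gcongr
    linarith
  have hfin : ((n : ℝ) / 2) ^ k * 2 ^ (-(k * (c * Real.logb 2 k + g n))) ≤ 2 ^ (C * x) :=
    le_trans (by gcongr) hcount
  have hlog := Real.logb_le_logb_of_le (b := 2) (by norm_num) (by positivity) hfin
  rw [Real.logb_mul (by positivity) (by positivity), Real.logb_pow,
    Real.logb_rpow (by norm_num) (by norm_num), Real.logb_rpow (by norm_num) (by norm_num),
    Real.logb_div hn0.ne' (by norm_num), Real.logb_self_eq_one (by norm_num)] at hlog
  have hCx : C * x ≤ k * C := by nlinarith
  have h5 : (k : ℝ) * (Real.logb 2 n - 1 - (c * Real.logb 2 k + g n)) ≤ k * C := by linarith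
  have h6 := le_of_mul_le_mul_left h5 hk0
  have hlk : Real.logb 2 k ≤ 1 + δ * Real.logb 2 n := by
    have := Real.logb_le_logb_of_le (b := 2) (by norm_num) hk0 hkx2
    rwa [Real.logb_mul (by norm_num) (by positivity), Real.logb_self_eq_one (by norm_num), hx,
      Real.logb_rpow_eq_mul_logb_of_pos hn0] at this
  have h7 : c * Real.logb 2 k ≤ c + (1 - c * ε) * Real.logb 2 n := by
    have := mul_le_mul_of_nonneg_left hlk hc0.le
    rw [mul_add, ← mul_assoc, hcδ] at this
    linarith
  have hL : 0 < Real.logb 2 n := by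
    have : 0 < 2 * (1 + C + c) / (c * ε) := by positivity
    linarith
  rw [div_lt_iff₀ hL] at h1
  have h8 : 2 * (1 + C + c) / (c * ε) < Real.logb 2 n := by linarith
  rw [div_lt_iff₀ hcε] at h8
  nlinarith
end

section
/- Let n ≥ 2 and ℓ ≥ 1, and let S be an n-ary linear de Bruijn sequence of order ℓ, i.e., a string over {0,…,n−1} containing every string of {0,…,n−1}^ℓ as a substring exactly once. Then S has length n^ℓ + ℓ − 1 and its ℓth-order empirical entropy satisfies H_ℓ(S) = 0. -/
open scoped BigOperators

lemma H0_eq_zero_of_length_le_one {A : Type*} [DecidableEq A] (L : List A) (h : L.length ≤ 1) :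
    H0 L = 0 := by
  match L, h with
  | [], _ => simp [H0]
  | [a], _ => simp [H0]

lemma filterMap_ite_length_le {A B : Type*} (p : A → Prop) [DecidablePred p] (f : A → Option B)
    (L : List A) :
    (L.filterMap fun i => if p i then f i else none).length ≤ (L.filter fun i => p i).length := by
  induction L with
  | nil => simp
  | cons a L ih =>
    by_cases hp : p a
    · rcases hf : f a with _ | b
      · simp [hp, hf] at ih ⊢; omega
      · simp [hp, hf] at ih ⊢; omega
    · simpa [hp] using ih

lemma follow_length_le {A : Type*} [DecidableEq A] (α S : List A) :
    (follow α S).length ≤ countOcc α S :=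
  filterMap_ite_length_le _ _ _

lemma countOcc_eq_card {A : Type*} [DecidableEq A] (α S : List A) :
    countOcc α S = ((Finset.range S.length).filter
      fun i => (S.drop i).take α.length = α).card := by
  rfl

lemma sum_countOcc {n ℓ : ℕ} (hℓ : 1 ≤ ℓ) (S : List (Fin n)) :
    ∑ α : Fin ℓ → Fin n, countOcc (List.ofFn α) S = S.length + 1 - ℓ := by
  have h1 : ∀ i ∈ Finset.range S.length,
      (∑ α : Fin ℓ → Fin n, if (S.drop i).take ℓ = List.ofFn α then 1 else 0)
        = if i < S.length + 1 - ℓ then 1 else 0 := by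
    intro i hi
    split_ifs with h
    · have hl : ((S.drop i).take ℓ).length = ℓ := by
        simp; omega
      obtain ⟨β, hβ⟩ : ∃ β : Fin ℓ → Fin n, (S.drop i).take ℓ = List.ofFn β := by
        refine ⟨fun j => ((S.drop i).take ℓ)[j.1]'(by rw [hl]; exact j.2), ?_⟩
        apply List.ext_getElem
        · simp only [hl, List.length_ofFn]
        · intro k h1 h2
          simp
      rw [hβ]
      simp [List.ofFn_inj]
    · apply Finset.sum_eq_zero
      intro α _
      rw [if_neg]
      intro hα
      have := congrArg List.length hα
      simp at this
      omega
  simp only [countOcc_eq_card, List.length_ofFn, Finset.card_filter]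
  rw [Finset.sum_comm, Finset.sum_congr rfl h1, ← Finset.card_filter]
  have : (Finset.range S.length).filter (fun i => i < S.length + 1 - ℓ)
      = Finset.range (S.length + 1 - ℓ) := by
    ext i; simp; omega
  rw [this, Finset.card_range]

/-- an `n`-ary linear de Bruijn sequence of order `ℓ` (a string over an
alphabet of size `n` containing every `ℓ`-tuple exactly once) has length `n^ℓ + ℓ − 1`
and `ℓ`th-order empirical entropy 0. -/
theorem statement14 {n ℓ : ℕ} (hn : 2 ≤ n) (hℓ : 1 ≤ ℓ) (S : List (Fin n))
    (hS : ∀ α : Fin ℓ → Fin n, countOcc (List.ofFn α) S = 1) :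
    S.length = n ^ ℓ + ℓ - 1 ∧ empEnt n ℓ S = 0 := by
  constructor
  · have h := sum_countOcc hℓ S
    simp [hS] at h
    have : 0 < n ^ ℓ := by positivity
    omega
  · unfold empEnt
    rw [if_neg (by omega), Finset.sum_eq_zero, mul_zero]
    intro α _
    rw [H0_eq_zero_of_length_le_one _ ((follow_length_le _ _).trans (hS α).le), mul_zero]
end
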